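/- arXiv:1610.02766 — 2 statements merged into one kernel-verified Lean document; each statement's English description precedes it below -/
import Mathlib

section
/- There exists a universal constant C₅ > 0 such that for every k ≥ 1, K = 2^k, every N with K^m ≤ N < K^{m+1}, every 1 ≤ j ≤ m, and all u, v ∈ V_N with |u − v|_∞ ≤ K^j: E[(H_{K^j}(u) − H_{K^j}(v))²] ≤ C₅ |u−v|_∞ / K^j; and for 1 ≤ j ≤ m−1 also E[(η_j(u) − η_j(v))²] ≤ C₅ |u−v|_∞ / K^j. -/
open MeasureTheory ProbabilityTheory Real Set Filter

/-- The lattice ℤ². -/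
abbrev Z2 := ℤ × ℤ

/-- Nearest-neighbor adjacency on ℤ². -/
def Adj (x y : Z2) : Prop := |x.1 - y.1| + |x.2 - y.2| = 1

/-- The `L^∞` distance on ℤ². -/
def linf (x y : Z2) : ℤ := max |x.1 - y.1| |x.2 - y.2|

/-- The Euclidean distance on ℤ². -/
noncomputable def eZ (x y : Z2) : ℝ :=
  Real.sqrt (((x.1 - y.1 : ℤ) : ℝ) ^ 2 + ((x.2 - y.2 : ℤ) : ℝ) ^ 2)

/-- Inner boundary `∂B` of a set `B ⊆ ℤ²`: points of `B` having a nearest neighbor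
outside `B`. -/
def bdry (B : Set Z2) : Set Z2 := {z | z ∈ B ∧ ∃ w, Adj z w ∧ w ∉ B}

/-- Number of nearest-neighbor paths of length `t` from `x` to `y` avoiding `∂B`. -/
noncomputable def nWalks (B : Set Z2) (t : ℕ) (x y : Z2) : ℕ :=
  Nat.card {f : Fin (t + 1) → Z2 //
    f 0 = x ∧ f (Fin.last t) = y ∧ (∀ i, f i ∉ bdry B) ∧
    ∀ i : Fin t, Adj (f i.castSucc) (f i.succ)}

/-- The Green function of simple random walk on ℤ² killed upon hitting `∂B`:
`G_B(x,y) = E_x [∑_{t=0}^{τ-1} 1_{S_t = y}]`, where `τ` is the hitting time of `∂B`. -/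
noncomputable def greenFn (B : Set Z2) (x y : Z2) : ℝ :=
  ∑' t : ℕ, (1 / 4 : ℝ) ^ t * nWalks B t x y

/-- A centered (jointly) Gaussian family: every finite linear combination is a
centered Gaussian random variable. -/
def IsCenteredGaussianFamily {Ω : Type*} [MeasureSpace Ω] {ι : Type*} (f : ι → Ω → ℝ) : Prop :=
  ∀ (s : Finset ι) (c : ι → ℝ), ∃ v : NNReal,
    Measure.map (fun ω => ∑ i ∈ s, c i * f i ω) (ℙ : Measure Ω) = gaussianReal 0 v

/-- `η` is a discrete Gaussian free field on `B` with Dirichlet boundary conditions: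
a centered Gaussian field, vanishing outside `B`, whose covariance on `B` is the
Green function of simple random walk killed at `∂B`. -/
def IsDGFF {Ω : Type*} [MeasureSpace Ω] (B : Set Z2) (η : Z2 → Ω → ℝ) : Prop :=
  IsCenteredGaussianFamily (fun z : Z2 => η z) ∧
  (∀ z, z ∉ B → η z = 0) ∧
  (∀ x ∈ B, ∀ y ∈ B, ∫ ω, η x ω * η y ω = greenFn B x y)

/-- `F` is the harmonic extension of `η` from outside `B`: it agrees with `η` on
`B^c ∪ ∂B` and is discrete harmonic on `B ∖ ∂B`. -/
def IsHarmExt {Ω : Type*} [MeasureSpace Ω] (η F : Z2 → Ω → ℝ) (B : Set Z2) : Prop :=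
  (∀ z, z ∉ B \ bdry B → F z = η z) ∧
  (∀ z ∈ B \ bdry B, ∀ ω, 4 * F z ω =
    F (z.1 + 1, z.2) ω + F (z.1 - 1, z.2) ω + F (z.1, z.2 + 1) ω + F (z.1, z.2 - 1) ω)

/-- The box of side length `ℓ` centered at `x`. -/
def boxZ (x : Z2) (ℓ : ℤ) : Set Z2 :=
  {z | x.1 - ℓ / 2 ≤ z.1 ∧ z.1 ≤ x.1 + ℓ / 2 ∧ x.2 - ℓ / 2 ≤ z.2 ∧ z.2 ≤ x.2 + ℓ / 2}

/-- `V_N = [0,N)² ∩ ℤ²`. -/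
def VN (N : ℕ) : Set Z2 := {z | 0 ≤ z.1 ∧ z.1 < (N : ℤ) ∧ 0 ≤ z.2 ∧ z.2 < (N : ℤ)}

/-- `V_{5N} = [-2N, 3N)² ∩ ℤ²`. -/
def V5N (N : ℕ) : Set Z2 :=
  {z | -(2 * (N : ℤ)) ≤ z.1 ∧ z.1 < 3 * (N : ℤ) ∧ -(2 * (N : ℤ)) ≤ z.2 ∧ z.2 < 3 * (N : ℤ)}

/-- The field `η_j`: `η_0 = η^{V_{5N}} - H_K` and `η_j = H_{K^j} - H_{K^{j+1}}` for
`j ≥ 1`, where `H ℓ x` denotes the value at `x` of the harmonic extension of the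
field `η` from outside the box of side `ℓ` centered at `x`. -/
def etaJ {Ω : Type*} (η : Z2 → Ω → ℝ) (H : ℤ → Z2 → Ω → ℝ) (K : ℕ) (j : ℕ) (x : Z2) :
    Ω → ℝ :=
  if j = 0 then fun ω => η x ω - H (K : ℤ) x ω
  else fun ω => H ((K : ℤ) ^ j) x ω - H ((K : ℤ) ^ (j + 1)) x ω

/-- A path in `V` given as a nonempty list of vertices of `V` in which consecutive
vertices are nearest neighbors. -/
def LPathIn (V : Set Z2) (P : List Z2) : Prop :=
  P ≠ [] ∧ P.Chain' Adj ∧ ∀ z ∈ P, z ∈ V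

/-- Sum of a function over the four neighbors. -/
def nbS (f : Z2 → ℝ) (z : Z2) : ℝ :=
  f (z.1 + 1, z.2) + f (z.1 - 1, z.2) + f (z.1, z.2 + 1) + f (z.1, z.2 - 1)

/-- Discrete maximum principle. -/
lemma maxP (D : Finset Z2) (f : Z2 → ℝ) (h1 : ∀ z ∈ D, 4 * f z ≤ nbS f z)
    (h2 : ∀ z, z ∉ D → f z ≤ 0) (z : Z2) : f z ≤ 0 := by
  by_contra hz
  push Not at hz
  have hzD : z ∈ D := by
    by_contra h; exact absurd (h2 z h) (not_le.mpr hz)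
  obtain ⟨y, hyD, hy⟩ := D.exists_max_image f ⟨z, hzD⟩
  have hM : ∀ x, f x ≤ f y := by
    intro x
    by_cases hx : x ∈ D
    · exact hy x hx
    · exact (h2 x hx).trans (hz.le.trans (hy z hzD))
  have hpos : 0 < f y := hz.trans_le (hy z hzD)
  obtain ⟨w, hw, hwm⟩ := (D.filter (fun x => f x = f y)).exists_max_image (fun x => x.1)
    ⟨y, by simp [hyD]⟩
  rw [Finset.mem_filter] at hw
  have h := h1 w hw.1
  unfold nbS at h
  have e1 := hM (w.1 + 1, w.2)
  have e2 := hM (w.1 - 1, w.2)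
  have e3 := hM (w.1, w.2 + 1)
  have e4 := hM (w.1, w.2 - 1)
  have e5 : f (w.1 + 1, w.2) = f y := by linarith [hw.2]
  have e6 : (w.1 + 1, w.2) ∈ D := by
    by_contra hc
    have := h2 _ hc
    linarith
  have := hwm (w.1 + 1, w.2) (by simp [e5, e6])
  simp at this

open Classical in
/-- Zero extension. -/
noncomputable def zext (D : Finset Z2) (f : D → ℝ) (z : Z2) : ℝ :=
  if h : z ∈ D then f ⟨z, h⟩ else 0

/-- The Dirichlet Laplacian. -/
noncomputable def dirL (D : Finset Z2) : (D → ℝ) →ₗ[ℝ] (D → ℝ) where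
  toFun f := fun z => 4 * zext D f z - nbS (zext D f) z
  map_add' f g := by
    have : ∀ z, zext D (f + g) z = zext D f z + zext D g z := by
      intro z; unfold zext; split_ifs <;> simp
    funext z; simp only [nbS, this, Pi.add_apply]; ring
  map_smul' c f := by
    have : ∀ z, zext D (c • f) z = c * zext D f z := by
      intro z; unfold zext; split_ifs <;> simp
    funext z; simp only [nbS, this, Pi.smul_apply, smul_eq_mul, RingHom.id_apply]; ring

lemma dirichlet_exists (D : Finset Z2) (b : Z2 → ℝ) :
    ∃ f : Z2 → ℝ, (∀ z, z ∉ D → f z = b z) ∧ ∀ z ∈ D, 4 * f z = nbS f z := by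
  classical
  have hinj : Function.Injective (dirL D) := by
    rw [← LinearMap.ker_eq_bot, LinearMap.ker_eq_bot']
    intro f hf
    have h1 : ∀ z ∈ D, 4 * zext D f z = nbS (zext D f) z := by
      intro z hz
      have := congrFun hf ⟨z, hz⟩
      simp only [dirL, LinearMap.coe_mk, AddHom.coe_mk, Pi.zero_apply] at this
      linarith
    have h2 : ∀ z, z ∉ D → zext D f z = 0 := by
      intro z hz; simp [zext, hz]
    have h3 := maxP D (zext D f) (fun z hz => (h1 z hz).le) (fun z hz => (h2 z hz).le)
    have h4 := maxP D (fun z => - zext D f z)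
      (fun z hz => by have := h1 z hz; unfold nbS at *; linarith)
      (fun z hz => by simp [h2 z hz])
    funext z
    have e : zext D f z = f z := by simp [zext]
    have := h3 z; have := h4 z
    simp only [Pi.zero_apply]
    linarith
  have hsurj := LinearMap.injective_iff_surjective.mp hinj
  let b0 : Z2 → ℝ := fun z => if z ∈ D then 0 else b z
  obtain ⟨f, hf⟩ := hsurj (fun z => nbS b0 z)
  refine ⟨fun z => zext D f z + b0 z, ?_, ?_⟩
  · intro z hz; simp [zext, b0, hz]
  · intro z hz
    have := congrFun hf ⟨z, hz⟩
    simp only [dirL, LinearMap.coe_mk, AddHom.coe_mk] at this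
    have e : b0 z = 0 := by simp [b0, hz]
    simp only [nbS] at *
    linarith

/-- The superharmonic barrier. -/
noncomputable def psi (s t : ℝ) : ℝ := s / (s ^ 2 + t ^ 2 + 3)

lemma psi_super (s t : ℝ) (hs : 0 ≤ s) :
    psi (s + 1) t + psi (s - 1) t + psi s (t + 1) + psi s (t - 1) ≤ 4 * psi s t := by
  unfold psi
  set Q := s ^ 2 + t ^ 2 + 3 with hQ
  have q0 : 0 < Q := by positivity
  have q1 : 0 < (Q + 1) ^ 2 - 4 * s ^ 2 := by
    have : (Q + 1) ^ 2 - 4 * s ^ 2 = ((s + 1) ^ 2 + t ^ 2 + 3) * ((s - 1) ^ 2 + t ^ 2 + 3) := by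
      rw [hQ]; ring
    rw [this]; positivity
  have q2 : 0 < (Q + 1) ^ 2 - 4 * t ^ 2 := by
    have : (Q + 1) ^ 2 - 4 * t ^ 2 = (s ^ 2 + (t + 1) ^ 2 + 3) * (s ^ 2 + (t - 1) ^ 2 + 3) := by
      rw [hQ]; ring
    rw [this]; positivity
  have a1 : (s + 1) / ((s + 1) ^ 2 + t ^ 2 + 3) + (s - 1) / ((s - 1) ^ 2 + t ^ 2 + 3)
      = 2 * s * ((Q - 1) / ((Q + 1) ^ 2 - 4 * s ^ 2)) := by
    have p1 : (s + 1) ^ 2 + t ^ 2 + 3 ≠ 0 := by positivity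
    have p2 : (s - 1) ^ 2 + t ^ 2 + 3 ≠ 0 := by positivity
    rw [div_add_div _ _ p1 p2, ← mul_div_assoc, div_eq_div_iff (mul_ne_zero p1 p2) q1.ne', hQ]
    ring
  have a2 : s / (s ^ 2 + (t + 1) ^ 2 + 3) + s / (s ^ 2 + (t - 1) ^ 2 + 3)
      = 2 * s * ((Q + 1) / ((Q + 1) ^ 2 - 4 * t ^ 2)) := by
    have p1 : s ^ 2 + (t + 1) ^ 2 + 3 ≠ 0 := by positivity
    have p2 : s ^ 2 + (t - 1) ^ 2 + 3 ≠ 0 := by positivity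
    rw [div_add_div _ _ p1 p2, ← mul_div_assoc, div_eq_div_iff (mul_ne_zero p1 p2) q2.ne', hQ]
    ring
  have key : (Q - 1) / ((Q + 1) ^ 2 - 4 * s ^ 2) + (Q + 1) / ((Q + 1) ^ 2 - 4 * t ^ 2) ≤ 2 / Q := by
    rw [div_add_div _ _ q1.ne' q2.ne', div_le_div_iff₀ (mul_pos q1 q2) q0]
    have hst : s ^ 2 = Q - 3 - t ^ 2 := by rw [hQ]; ring
    have ht : t ^ 2 ≤ Q := by rw [hQ]; nlinarith [sq_nonneg s]
    have expand : 2 * (((Q + 1) ^ 2 - 4 * s ^ 2) * ((Q + 1) ^ 2 - 4 * t ^ 2))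
        - ((Q - 1) * ((Q + 1) ^ 2 - 4 * t ^ 2) + ((Q + 1) ^ 2 - 4 * s ^ 2) * (Q + 1)) * Q
        = 6 * Q ^ 2 + 48 * Q + 26 + 32 * (s ^ 2 * t ^ 2) + 4 * Q * (s ^ 2 - t ^ 2) := by
      rw [hQ]; ring
    have : 0 ≤ s ^ 2 * t ^ 2 := by positivity
    nlinarith [mul_nonneg q0.le (sub_nonneg.mpr ht), mul_nonneg q0.le (sq_nonneg s)]
  have : 4 * (s / Q) = 2 * s * (2 / Q) := by ring
  rw [this]
  have := mul_le_mul_of_nonneg_left key (by positivity : 0 ≤ 2 * s)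
  linarith

/-- Interior of the box of radius `h`. -/
noncomputable def intB (h : ℤ) : Finset Z2 := Finset.Ioo (-h) h ×ˢ Finset.Ioo (-h) h
/-- The box of radius `h`. -/
noncomputable def bigB (h : ℤ) : Finset Z2 := Finset.Icc (-h) h ×ˢ Finset.Icc (-h) h
/-- The sphere of radius `h`. -/
noncomputable def sph (h : ℤ) : Finset Z2 := bigB h \ intB h

lemma mem_intB (h : ℤ) (z : Z2) : z ∈ intB h ↔ (-h < z.1 ∧ z.1 < h) ∧ (-h < z.2 ∧ z.2 < h) := by
  simp [intB]
lemma mem_bigB (h : ℤ) (z : Z2) : z ∈ bigB h ↔ (-h ≤ z.1 ∧ z.1 ≤ h) ∧ (-h ≤ z.2 ∧ z.2 ≤ h) := by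
  simp [bigB]
lemma mem_sph (h : ℤ) (z : Z2) : z ∈ sph h ↔ z ∈ bigB h ∧ z ∉ intB h := by
  simp [sph]

lemma maxBox (h : ℤ) (f : Z2 → ℝ) (h1 : ∀ z ∈ intB h, 4 * f z ≤ nbS f z)
    (h2 : ∀ z ∈ sph h, f z ≤ 0) (z : Z2) (hz : z ∈ bigB h) : f z ≤ 0 := by
  classical
  have := maxP (intB h) (fun x => if x ∈ bigB h then f x else 0) ?_ ?_ z
  · simpa [hz] using this
  · intro x hx
    have hx' := (mem_intB h x).mp hx
    have e0 : x ∈ bigB h := by rw [mem_bigB]; omega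
    have e1 : (x.1 + 1, x.2) ∈ bigB h := by rw [mem_bigB]; simp only; omega
    have e2 : (x.1 - 1, x.2) ∈ bigB h := by rw [mem_bigB]; simp only; omega
    have e3 : (x.1, x.2 + 1) ∈ bigB h := by rw [mem_bigB]; simp only; omega
    have e4 : (x.1, x.2 - 1) ∈ bigB h := by rw [mem_bigB]; simp only; omega
    have := h1 x hx
    simpa only [nbS, e0, e1, e2, e3, e4, if_true] using this
  · intro x hx
    by_cases hb : x ∈ bigB h
    · simpa [hb] using h2 x ((mem_sph h x).mpr ⟨hb, hx⟩)
    · simp [hb]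

lemma harmMeas (h : ℤ) (hh : 1 ≤ h) : ∃ p : Z2 → ℝ, (∀ z ∈ sph h, |p z| ≤ 4 / (h : ℝ)) ∧
    ∀ F : Z2 → ℝ, (∀ z ∈ intB h, 4 * F z = nbS F z) → F (0, 0) = ∑ z ∈ sph h, p z * F z := by
  classical
  have hex : ∀ z : Z2, ∃ f : Z2 → ℝ, (∀ x, x ∉ intB h → f x = if x = z then 1 else 0) ∧
      ∀ x ∈ intB h, 4 * f x = nbS f x := fun z => dirichlet_exists (intB h) _
  choose om hom1 hom2 using hex
  have h0 : ((0, 0) : Z2) ∈ bigB h := by rw [mem_bigB]; simp only; omega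
  have hR : (1 : ℝ) ≤ h := by exact_mod_cast hh
  refine ⟨fun z => om z (0, 0), ?_, ?_⟩
  · intro z hz
    have hz' := (mem_sph h z).mp hz
    have hzb := (mem_bigB h z).mp hz'.1
    have hzi := hz'.2
    rw [mem_intB] at hzi
    have hnn : 0 ≤ om z (0, 0) := by
      have := maxBox h (fun x => - om z x)
        (fun x hx => by have := hom2 z x hx; unfold nbS at *; linarith)
        (fun x hx => by
          rw [hom1 z x ((mem_sph h x).mp hx).2]; split_ifs <;> simp) (0, 0) h0
      simpa using this
    have hbar : ∀ ψ : Z2 → ℝ, (∀ x ∈ bigB h, 0 ≤ ψ x) → (∀ x ∈ intB h, nbS ψ x ≤ 4 * ψ x) →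
        1 / 4 ≤ ψ z → om z (0, 0) ≤ 4 * ψ (0, 0) := by
      intro ψ a1 a2 a3
      have := maxBox h (fun x => om z x - 4 * ψ x)
        (fun x hx => by have := hom2 z x hx; have := a2 x hx; unfold nbS at *; linarith)
        (fun x hx => by
          rw [hom1 z x ((mem_sph h x).mp hx).2]
          have := a1 x ((mem_sph h x).mp hx).1
          split_ifs with e
          · rw [e]; linarith
          · linarith) (0, 0) h0
      linarith
    have hpsi0 : ∀ t : ℝ, 4 * psi (h + 1) t ≤ 4 / (h : ℝ) := by
      intro t
      unfold psi
      rw [← mul_div_assoc, div_le_div_iff₀ (by positivity) (by positivity)]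
      nlinarith [sq_nonneg t]
    have hpsi1 : (1 : ℝ) / 4 ≤ psi 1 0 := by unfold psi; norm_num
    rw [abs_of_nonneg hnn]
    have hside : z.1 = h ∨ z.1 = -h ∨ z.2 = h ∨ z.2 = -h := by omega
    rcases hside with e | e | e | e
    · refine (hbar (fun x => psi ((h : ℝ) + 1 - x.1) (x.2 - z.2)) ?_ ?_ ?_).trans ?_
      · intro x hx
        have hx' := (mem_bigB h x).mp hx
        have : (x.1 : ℝ) ≤ h := by exact_mod_cast hx'.1.2
        exact div_nonneg (by linarith) (by positivity)
      · intro x hx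
        have hx' := (mem_intB h x).mp hx
        have : (x.1 : ℝ) ≤ h := by exact_mod_cast hx'.1.2.le
        have := psi_super ((h : ℝ) + 1 - x.1) (x.2 - z.2) (by linarith)
        simp only [nbS]; push_cast
        ring_nf at this ⊢
        linarith
      · simp [e]
        simpa using hpsi1
      · simpa using hpsi0 _
    · refine (hbar (fun x => psi ((h : ℝ) + 1 + x.1) (x.2 - z.2)) ?_ ?_ ?_).trans ?_
      · intro x hx
        have hx' := (mem_bigB h x).mp hx
        have : (-h : ℝ) ≤ x.1 := by exact_mod_cast hx'.1.1
        exact div_nonneg (by linarith) (by positivity)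
      · intro x hx
        have hx' := (mem_intB h x).mp hx
        have : (-h : ℝ) ≤ x.1 := by exact_mod_cast hx'.1.1.le
        have := psi_super ((h : ℝ) + 1 + x.1) (x.2 - z.2) (by linarith)
        simp only [nbS]; push_cast
        ring_nf at this ⊢
        linarith
      · simp [e]
        simpa using hpsi1
      · simpa using hpsi0 _
    · refine (hbar (fun x => psi ((h : ℝ) + 1 - x.2) (x.1 - z.1)) ?_ ?_ ?_).trans ?_
      · intro x hx
        have hx' := (mem_bigB h x).mp hx
        have : (x.2 : ℝ) ≤ h := by exact_mod_cast hx'.2.2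
        exact div_nonneg (by linarith) (by positivity)
      · intro x hx
        have hx' := (mem_intB h x).mp hx
        have : (x.2 : ℝ) ≤ h := by exact_mod_cast hx'.2.2.le
        have := psi_super ((h : ℝ) + 1 - x.2) (x.1 - z.1) (by linarith)
        simp only [nbS]; push_cast
        ring_nf at this ⊢
        linarith
      · simp [e]
        simpa using hpsi1
      · simpa using hpsi0 _
    · refine (hbar (fun x => psi ((h : ℝ) + 1 + x.2) (x.1 - z.1)) ?_ ?_ ?_).trans ?_
      · intro x hx
        have hx' := (mem_bigB h x).mp hx
        have : (-h : ℝ) ≤ x.2 := by exact_mod_cast hx'.2.1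
        exact div_nonneg (by linarith) (by positivity)
      · intro x hx
        have hx' := (mem_intB h x).mp hx
        have : (-h : ℝ) ≤ x.2 := by exact_mod_cast hx'.2.1.le
        have := psi_super ((h : ℝ) + 1 + x.2) (x.1 - z.1) (by linarith)
        simp only [nbS]; push_cast
        ring_nf at this ⊢
        linarith
      · simp [e]
        simpa using hpsi1
      · simpa using hpsi0 _
  · intro F hF
    set G : Z2 → ℝ := fun x => ∑ z ∈ sph h, om z x * F z with hG
    have hG1 : ∀ x ∈ sph h, G x = F x := by
      intro x hx
      have : ∀ z ∈ sph h, om z x * F z = if x = z then F z else 0 := by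
        intro z hz
        rw [hom1 z x ((mem_sph h x).mp hx).2]; split_ifs <;> simp
      rw [hG]; simp only
      rw [Finset.sum_congr rfl this, Finset.sum_ite_eq]
      simp [hx]
    have hG2 : ∀ x ∈ intB h, 4 * G x = nbS G x := by
      intro x hx
      simp only [hG, nbS, ← Finset.sum_add_distrib, Finset.mul_sum]
      refine Finset.sum_congr rfl fun z _ => ?_
      have := hom2 z x hx
      unfold nbS at this
      linear_combination (F z) * this
    have l1 := maxBox h (fun x => F x - G x)
      (fun x hx => by have := hF x hx; have := hG2 x hx; unfold nbS at *; linarith)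
      (fun x hx => by have := hG1 x hx; linarith) (0, 0) h0
    have l2 := maxBox h (fun x => G x - F x)
      (fun x hx => by have := hF x hx; have := hG2 x hx; unfold nbS at *; linarith)
      (fun x hx => by have := hG1 x hx; linarith) (0, 0) h0
    change F (0, 0) = G (0, 0)
    linarith
lemma hasSum_congr_fun {f g : Z2 → ℝ} {a : ℝ} (h : ∀ x, f x = g x) : HasSum f a ↔ HasSum g a := by
  rw [funext h]

/-- Cauchy-Schwarz along an injective family. -/
lemma cs_inj {ι : Type*} (G : Z2 → ℝ) (E : ℝ) (hE : ∀ T : Finset Z2, ∑ x ∈ T, G x ^ 2 ≤ E)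
    (I : Finset ι) (φ : ι → Z2) (hφ : Function.Injective φ) :
    ∑ i ∈ I, |G (φ i)| ≤ √((I.card : ℝ) * E) := by
  classical
  apply Real.le_sqrt_of_sq_le
  refine (sq_sum_le_card_mul_sum_sq).trans ?_
  refine mul_le_mul_of_nonneg_left ?_ (by positivity)
  have := hE (I.image φ)
  rw [Finset.sum_image (fun a _ b _ hab => hφ hab)] at this
  simpa using this

lemma tele (f : ℤ → ℝ) (a : ℤ) (d : ℕ) :
    |f a - f (a + d)| ≤ ∑ i ∈ Finset.range d, |f (a + i + 1) - f (a + i)| := by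
  induction d with
  | zero => simp
  | succ n ih =>
    rw [Finset.sum_range_succ]
    have := abs_sub_le (f a) (f (a + n)) (f (a + (n + 1 : ℕ)))
    have e : f (a + (n + 1 : ℕ)) = f (a + n + 1) := by congr 1; push_cast; ring
    rw [e] at this ⊢
    have := abs_sub_comm (f (a + n)) (f (a + n + 1))
    linarith

lemma vert_side (g : Z2 → ℝ) (E : ℝ)
    (h1 : ∀ T : Finset Z2, ∑ x ∈ T, (g (x.1 + 1, x.2) - g x) ^ 2 ≤ E)
    (A : Finset ℤ) (d : ℕ) (a b : ℤ) :
    ∑ t ∈ A, |g (a, b + t) - g (a + d, b + t)| ≤ √((A.card * d : ℕ) * E) := by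
  refine (Finset.sum_le_sum fun t _ => tele (fun r => g (r, b + t)) a d).trans ?_
  rw [← Finset.sum_product']
  have := cs_inj (fun x => g (x.1 + 1, x.2) - g x) E h1 (A ×ˢ Finset.range d)
    (fun i => (a + i.2, b + i.1)) (by
      rintro ⟨x, y⟩ ⟨x', y'⟩ hxy
      simp at hxy ⊢; omega)
  simpa using this

lemma vert_side' (g : Z2 → ℝ) (E : ℝ)
    (h1 : ∀ T : Finset Z2, ∑ x ∈ T, (g (x.1, x.2 + 1) - g x) ^ 2 ≤ E)
    (A : Finset ℤ) (d : ℕ) (a b : ℤ) :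
    ∑ t ∈ A, ∑ i ∈ Finset.range d, |g (b + t, a + i + 1) - g (b + t, a + i)|
      ≤ √((A.card * d : ℕ) * E) := by
  rw [← Finset.sum_product']
  have := cs_inj (fun x => g (x.1, x.2 + 1) - g x) E h1 (A ×ˢ Finset.range d)
    (fun i => (b + i.1, a + i.2)) (by
      rintro ⟨x, y⟩ ⟨x', y'⟩ hxy
      simp at hxy ⊢; omega)
  simpa using this

lemma hor_side (g : Z2 → ℝ) (E : ℝ)
    (h1 : ∀ T : Finset Z2, ∑ x ∈ T, (g (x.1 + 1, x.2) - g x) ^ 2 ≤ E)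
    (h2 : ∀ T : Finset Z2, ∑ x ∈ T, (g (x.1, x.2 + 1) - g x) ^ 2 ≤ E)
    (A : Finset ℤ) (d : ℕ) (a b : ℤ) :
    ∑ s ∈ A, |g (a + s, b) - g (a + s + d, b)| ≤ 3 * √((A.card * d : ℕ) * E) := by
  set X := √((A.card * d : ℕ) * E) with hX
  rcases Nat.eq_zero_or_pos d with hd | hd
  · subst hd
    simp [hX]
  have hd' : (0 : ℝ) < d := by exact_mod_cast hd
  have point : ∀ s ∈ A, ∀ i ∈ Finset.range d, |g (a + s, b) - g (a + s + d, b)| ≤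
      (∑ i ∈ Finset.range d, |g (a + s, b + i + 1) - g (a + s, b + i)|)
      + |g (a + s, b + i) - g (a + s + d, b + i)|
      + ∑ i ∈ Finset.range d, |g (a + d + s, b + i + 1) - g (a + d + s, b + i)| := by
    intro s _ i hi
    have hsub : Finset.range i ⊆ Finset.range d := by
      intro x hx; simp at *; omega
    have t1 := (tele (fun r => g (a + s, r)) b i).trans
      (Finset.sum_le_sum_of_subset_of_nonneg hsub fun _ _ _ => abs_nonneg _)
    have t2 := (tele (fun r => g (a + d + s, r)) b i).trans
      (Finset.sum_le_sum_of_subset_of_nonneg hsub fun _ _ _ => abs_nonneg _)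
    have e : a + s + (d : ℤ) = a + d + s := by ring
    rw [e]
    have q1 := abs_sub_le (g (a + s, b)) (g (a + s, b + i)) (g (a + d + s, b))
    have q2 := abs_sub_le (g (a + s, b + i)) (g (a + d + s, b + i)) (g (a + d + s, b))
    have q3 := abs_sub_comm (g (a + d + s, b + i)) (g (a + d + s, b))
    linarith
  have tot := Finset.sum_le_sum fun s hs => Finset.sum_le_sum (point s hs)
  simp only [Finset.sum_const, Finset.card_range, nsmul_eq_mul, Finset.sum_add_distrib,
    ← Finset.mul_sum] at tot
  have b1 := vert_side' g E h2 A d b a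
  have b3 := vert_side' g E h2 A d b (a + d)
  have b2 : ∑ s ∈ A, ∑ i ∈ Finset.range d, |g (a + s, b + i) - g (a + s + d, b + i)| ≤ d * X := by
    have hr : ∀ r ∈ Finset.range d,
        ∑ s ∈ A, ∑ i ∈ Finset.range d, |g (a + s + r + 1, b + i) - g (a + s + r, b + i)| ≤ X := by
      intro r _
      rw [← Finset.sum_product']
      have := cs_inj (fun x => g (x.1 + 1, x.2) - g x) E h1 (A ×ˢ Finset.range d)
        (fun i => (a + i.1 + r, b + i.2)) (by
          rintro ⟨x, y⟩ ⟨x', y'⟩ hxy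
          simp at hxy ⊢; omega)
      simpa [hX] using this
    have := Finset.sum_le_sum hr
    rw [Finset.sum_const, Finset.card_range, nsmul_eq_mul] at this
    refine le_trans ?_ this
    rw [Finset.sum_comm (s := Finset.range d) (t := A)]
    refine Finset.sum_le_sum fun s _ => ?_
    rw [Finset.sum_comm]
    refine Finset.sum_le_sum fun i _ => ?_
    exact tele (fun r => g (r, b + i)) (a + s) d
  rw [← hX] at b1 b3
  have := mul_le_mul_of_nonneg_left b1 hd'.le
  have := mul_le_mul_of_nonneg_left b3 hd'.le
  refine le_of_mul_le_mul_left (a := (d : ℝ)) ?_ hd'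
  linarith

/-- The key deterministic inequality, horizontal displacement. -/
lemma key_hor (g : Z2 → ℝ) (E : ℝ)
    (h1 : ∀ T : Finset Z2, ∑ x ∈ T, (g (x.1 + 1, x.2) - g x) ^ 2 ≤ E)
    (h2 : ∀ T : Finset Z2, ∑ x ∈ T, (g (x.1, x.2 + 1) - g x) ^ 2 ≤ E)
    (h : ℤ) (hh : 1 ≤ h) (d : ℕ) (u : Z2) :
    ∑ z ∈ sph h, |g (u.1 + z.1, u.2 + z.2) - g (u.1 + z.1 + d, u.2 + z.2)|
      ≤ 8 * √(3 * h * d * E) := by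
  classical
  set A := Finset.Icc (-h) h with hA
  have hE : 0 ≤ E := by simpa using h1 ∅
  have hcard : ((A.card * d : ℕ) : ℝ) ≤ 3 * h * d := by
    have : (A.card : ℤ) ≤ 3 * h := by rw [hA, Int.card_Icc]; omega
    have : (A.card : ℝ) ≤ 3 * h := by exact_mod_cast this
    push_cast
    exact mul_le_mul_of_nonneg_right this (by positivity)
  have hX : √((A.card * d : ℕ) * E) ≤ √(3 * h * d * E) :=
    Real.sqrt_le_sqrt (mul_le_mul_of_nonneg_right hcard hE)
  set φ : Z2 → ℝ := fun z => |g (u.1 + z.1, u.2 + z.2) - g (u.1 + z.1 + d, u.2 + z.2)| with hφ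
  have hφ0 : ∀ z, 0 ≤ φ z := fun z => abs_nonneg _
  have hsub : sph h ⊆ ((({h} : Finset ℤ) ×ˢ A) ∪ (({-h} : Finset ℤ) ×ˢ A)) ∪
      ((A ×ˢ ({h} : Finset ℤ)) ∪ (A ×ˢ ({-h} : Finset ℤ))) := by
    intro z hz
    rw [mem_sph, mem_bigB, mem_intB] at hz
    simp only [Finset.mem_union, Finset.mem_product, Finset.mem_singleton, hA, Finset.mem_Icc]
    omega
  have hun : ∀ S T : Finset Z2, ∑ z ∈ S ∪ T, φ z ≤ ∑ z ∈ S, φ z + ∑ z ∈ T, φ z := by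
    intro S T
    rw [← Finset.sum_union_inter]
    have := Finset.sum_nonneg (s := S ∩ T) (fun z _ => hφ0 z)
    linarith
  have s0 := Finset.sum_le_sum_of_subset_of_nonneg hsub (fun z _ _ => hφ0 z)
  have s1 := hun ((({h} : Finset ℤ) ×ˢ A) ∪ (({-h} : Finset ℤ) ×ˢ A))
      ((A ×ˢ ({h} : Finset ℤ)) ∪ (A ×ˢ ({-h} : Finset ℤ)))
  have s2 := hun (({h} : Finset ℤ) ×ˢ A) (({-h} : Finset ℤ) ×ˢ A)
  have s3 := hun (A ×ˢ ({h} : Finset ℤ)) (A ×ˢ ({-h} : Finset ℤ))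
  have v1 : ∀ c : ℤ, ∑ z ∈ ({c} : Finset ℤ) ×ˢ A, φ z ≤ √((A.card * d : ℕ) * E) := by
    intro c
    rw [Finset.sum_product, Finset.sum_singleton]
    exact vert_side g E h1 A d (u.1 + c) u.2
  have v2 : ∀ c : ℤ, ∑ z ∈ A ×ˢ ({c} : Finset ℤ), φ z ≤ 3 * √((A.card * d : ℕ) * E) := by
    intro c
    rw [Finset.sum_product]
    simp only [Finset.sum_singleton]
    exact hor_side g E h1 h2 A d u.1 (u.2 + c)
  have := v1 h; have := v1 (-h); have := v2 h; have := v2 (-h)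
  linarith

lemma sph_swap (h : ℤ) (z : Z2) : z.swap ∈ sph h ↔ z ∈ sph h := by
  simp only [mem_sph, mem_bigB, mem_intB, Prod.fst_swap, Prod.snd_swap]; tauto

/-- The key deterministic inequality, vertical displacement. -/
lemma key_ver (g : Z2 → ℝ) (E : ℝ)
    (h1 : ∀ T : Finset Z2, ∑ x ∈ T, (g (x.1 + 1, x.2) - g x) ^ 2 ≤ E)
    (h2 : ∀ T : Finset Z2, ∑ x ∈ T, (g (x.1, x.2 + 1) - g x) ^ 2 ≤ E)
    (h : ℤ) (hh : 1 ≤ h) (d : ℕ) (u : Z2) :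
    ∑ z ∈ sph h, |g (u.1 + z.1, u.2 + z.2) - g (u.1 + z.1, u.2 + z.2 + d)|
      ≤ 8 * √(3 * h * d * E) := by
  classical
  have H := key_hor (fun x => g x.swap) E ?_ ?_ h hh d u.swap
  · refine le_trans (le_of_eq ?_) H
    refine Finset.sum_bij' (fun z _ => z.swap) (fun z _ => z.swap) ?_ ?_ ?_ ?_ ?_
    · intro z hz; exact (sph_swap h z).mpr hz
    · intro z hz; exact (sph_swap h z).mpr hz
    · intro z _; simp
    · intro z _; simp
    · intro z _; simp
  · intro T
    have := h2 (T.image Prod.swap)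
    rw [Finset.sum_image (fun a _ b _ hab => Prod.swap_injective hab)] at this
    simpa using this
  · intro T
    have := h1 (T.image Prod.swap)
    rw [Finset.sum_image (fun a _ b _ hab => Prod.swap_injective hab)] at this
    simpa using this

/-- Summation by parts. -/
lemma parts (g : Z2 → ℝ) (V : Finset Z2) (hV : ∀ z, z ∉ V → g z = 0) :
    (∀ T : Finset Z2, ∑ x ∈ T, (g (x.1 + 1, x.2) - g x) ^ 2 ≤ ∑' x, g x * (4 * g x - nbS g x)) ∧
    (∀ T : Finset Z2, ∑ x ∈ T, (g (x.1, x.2 + 1) - g x) ^ 2 ≤ ∑' x, g x * (4 * g x - nbS g x)) := by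
  classical
  let e1 : Z2 ≃ Z2 := Equiv.addRight ((1, 0) : Z2)
  let e2 : Z2 ≃ Z2 := Equiv.addRight ((0, 1) : Z2)
  have he1 : ∀ x : Z2, e1 x = (x.1 + 1, x.2) := by
    intro x; ext <;> simp [e1]
  have he2 : ∀ x : Z2, e2 x = (x.1, x.2 + 1) := by
    intro x; ext <;> simp [e2]
  have sm : ∀ f : Z2 → ℝ, Summable (fun x => g x * f x) := by
    intro f
    refine summable_of_ne_finset_zero (s := V) ?_
    intro x hx; simp [hV x hx]
  have main : ∀ e : Z2 ≃ Z2, HasSum (fun x => (g (e x) - g x) ^ 2)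
      (∑' x, g x * (2 * g x - g (e x) - g (e.symm x))) := by
    intro e
    have a := (sm g).hasSum
    have b := (e.hasSum_iff (f := fun x => g x * g x)).mpr a
    have c := (sm (fun x => g (e x))).hasSum
    have c' := (sm (fun x => g (e.symm x))).hasSum
    have c2 := (e.hasSum_iff (f := fun x => g x * g (e.symm x))).mpr c'
    have hcc : ∑' x, g x * g (e.symm x) = ∑' x, g x * g (e x) := by
      refine c2.unique ?_
      refine (hasSum_congr_fun ?_).mpr c
      intro x; simp [mul_comm]
    have t := (((a.mul_left 2).sub c).sub c')
    have t' : HasSum (fun x => g x * (2 * g x - g (e x) - g (e.symm x)))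
        (2 * ∑' x, g x * g x - ∑' x, g x * g (e x) - ∑' x, g x * g (e.symm x)) := by
      refine (hasSum_congr_fun ?_).mpr t
      intro x; ring
    rw [t'.tsum_eq, hcc]
    have r := (a.add b).sub (c.mul_left 2)
    have r' := (hasSum_congr_fun (f := fun x => (g (e x) - g x) ^ 2) (fun x => by
      simp only [Function.comp]; ring)).mpr r
    convert r' using 1
    ring
  have m1 := main e1
  have m2 := main e2
  have hs1 : ∀ x : Z2, e1.symm x = (x.1 - 1, x.2) := by
    intro x; rw [Equiv.symm_apply_eq, he1]; simp
  have hs2 : ∀ x : Z2, e2.symm x = (x.1, x.2 - 1) := by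
    intro x; rw [Equiv.symm_apply_eq, he2]; simp
  have hsum : ∑' x, g x * (4 * g x - nbS g x) =
      ∑' x, g x * (2 * g x - g (e1 x) - g (e1.symm x))
      + ∑' x, g x * (2 * g x - g (e2 x) - g (e2.symm x)) := by
    rw [← (sm _).tsum_add (sm _)]
    refine tsum_congr fun x => ?_
    rw [he1, he2, hs1, hs2]; unfold nbS; ring
  have p1 := m1.nonneg (fun x => sq_nonneg _)
  have p2 := m2.nonneg (fun x => sq_nonneg _)
  constructor
  · intro T
    have := sum_le_hasSum T (fun x _ => sq_nonneg _) m1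
    simp only [he1] at this
    rw [hsum]; simp only [he1]; simp only [he1] at p1; linarith
  · intro T
    have := sum_le_hasSum T (fun x _ => sq_nonneg _) m2
    simp only [he2] at this
    rw [hsum]; simp only [he2]; simp only [he2] at p2; linarith
/-- The four neighbors. -/
noncomputable def nbrs (x : Z2) : Finset Z2 :=
  {(x.1 + 1, x.2), (x.1 - 1, x.2), (x.1, x.2 + 1), (x.1, x.2 - 1)}

lemma mem_nbrs (x y : Z2) : y ∈ nbrs x ↔ Adj x y := by
  obtain ⟨a, b⟩ := x
  obtain ⟨c, d⟩ := y
  simp only [nbrs, Adj, Finset.mem_insert, Finset.mem_singleton, Prod.mk.injEq]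
  constructor
  · rintro (⟨rfl, rfl⟩ | ⟨rfl, rfl⟩ | ⟨rfl, rfl⟩ | ⟨rfl, rfl⟩) <;> simp
  · intro h
    rcases abs_cases (a - c) with ⟨h1, _⟩ | ⟨h1, _⟩ <;>
    rcases abs_cases (b - d) with ⟨h2, _⟩ | ⟨h2, _⟩ <;> omega

lemma sum_nbrs (f : Z2 → ℝ) (x : Z2) : ∑ y ∈ nbrs x, f y = nbS f x := by
  unfold nbrs nbS
  rw [Finset.sum_insert, Finset.sum_insert, Finset.sum_insert, Finset.sum_singleton]
  · ring
  all_goals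
    simp only [Finset.mem_insert, Finset.mem_singleton, Prod.mk.injEq]
    omega

/-- The type of walks counted by `nWalks`. -/
abbrev Wk (B : Set Z2) (t : ℕ) (x y : Z2) : Type :=
  {f : Fin (t + 1) → Z2 //
    f 0 = x ∧ f (Fin.last t) = y ∧ (∀ i, f i ∉ bdry B) ∧
    ∀ i : Fin t, Adj (f i.castSucc) (f i.succ)}

/-- Prepending a vertex. -/
def consW (B : Set Z2) (t : ℕ) (x y : Z2) (hx : x ∉ bdry B) :
    (Σ x' : {x' // x' ∈ nbrs x}, Wk B t x' y) → Wk B (t + 1) x y := fun p =>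
  ⟨Fin.cons x p.2.1, by
    obtain ⟨⟨x', hx'⟩, ⟨f, h0, h1, h2, h3⟩⟩ := p
    refine ⟨rfl, ?_, ?_, ?_⟩
    · rw [← Fin.succ_last, Fin.cons_succ]; exact h1
    · intro i
      refine Fin.cases ?_ (fun i => ?_) i
      · simpa using hx
      · simpa using h2 i
    · intro i
      refine Fin.cases ?_ (fun i => ?_) i
      · simp only [Fin.castSucc_zero, Fin.cons_zero, Fin.cons_succ, h0]
        exact (mem_nbrs _ _).mp hx'
      · rw [← Fin.succ_castSucc, Fin.cons_succ, Fin.cons_succ]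
        exact h3 i⟩

lemma consW_bij (B : Set Z2) (t : ℕ) (x y : Z2) (hx : x ∉ bdry B) :
    Function.Bijective (consW B t x y hx) := by
  constructor
  · rintro ⟨⟨x1, hx1⟩, ⟨f, hf⟩⟩ ⟨⟨x2, hx2⟩, ⟨f', hf'⟩⟩ h
    have h' : (Fin.cons x f : Fin (t + 2) → Z2) = Fin.cons x f' := congrArg Subtype.val h
    have hff : f = f' := Fin.cons_right_injective (α := fun _ => Z2) x h'
    subst hff
    have : x1 = x2 := hf.1.symm.trans hf'.1
    subst this
    rfl
  · rintro ⟨f, h0, h1, h2, h3⟩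
    refine ⟨⟨⟨f 1, ?_⟩, ⟨Fin.tail f, rfl, ?_, fun i => h2 _, fun i => ?_⟩⟩, ?_⟩
    · rw [mem_nbrs, ← h0]; exact h3 0
    · simpa [Fin.tail] using h1
    · have := h3 i.succ
      rw [← Fin.succ_castSucc] at this
      exact this
    · apply Subtype.ext
      simp only [consW]
      rw [← h0]
      exact Fin.cons_self_tail f

lemma nWalks_bdry (B : Set Z2) (t : ℕ) (x y : Z2) (hx : x ∈ bdry B) : nWalks B t x y = 0 := by
  unfold nWalks
  rw [Nat.card_eq_zero]
  left
  refine ⟨?_⟩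
  rintro ⟨f, h0, h1, h2, h3⟩
  exact h2 0 (h0 ▸ hx)

lemma nWalks_bdry' (B : Set Z2) (t : ℕ) (x y : Z2) (hy : y ∈ bdry B) : nWalks B t x y = 0 := by
  unfold nWalks
  rw [Nat.card_eq_zero]
  left
  refine ⟨?_⟩
  rintro ⟨f, h0, h1, h2, h3⟩
  exact h2 (Fin.last t) (h1 ▸ hy)

instance Wk_finite (B : Set Z2) (t : ℕ) (x y : Z2) : Finite (Wk B t x y) := by
  induction t generalizing x with
  | zero =>
    refine Finite.of_injective (β := Unit) (fun _ => ()) ?_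
    rintro ⟨f, hf⟩ ⟨f', hf'⟩ _
    apply Subtype.ext
    funext i
    have : i = 0 := by apply Fin.ext; have := i.2; simp only [Fin.val_zero]; omega
    rw [this]; simp only; rw [hf.1, hf'.1]
  | succ t ih =>
    by_cases hx : x ∈ bdry B
    · refine @Finite.of_subsingleton _ ⟨?_⟩
      rintro ⟨f, h0, h1, h2, h3⟩
      exact absurd (h0 ▸ hx) (h2 0)
    · exact Finite.of_surjective _ (consW_bij B t x y hx).2

lemma nWalks_succ (B : Set Z2) (t : ℕ) (x y : Z2) (hx : x ∉ bdry B) :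
    (nWalks B (t + 1) x y : ℝ) = nbS (fun x' => (nWalks B t x' y : ℝ)) x := by
  have h : nWalks B (t + 1) x y = ∑ x' : {x' // x' ∈ nbrs x}, nWalks B t x' y := by
    unfold nWalks
    rw [← Nat.card_congr (Equiv.ofBijective _ (consW_bij B t x y hx)), Nat.card_sigma]
  rw [h, Finset.sum_coe_sort (nbrs x) (fun x' => nWalks B t x' y), Nat.cast_sum, sum_nbrs]

open Classical in
lemma nWalks_zero (B : Set Z2) (x y : Z2) (hx : x ∉ bdry B) :
    nWalks B 0 x y = if x = y then 1 else 0 := by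
  unfold nWalks
  split_ifs with h
  · rw [Nat.card_eq_one_iff_unique]
    refine ⟨⟨?_⟩, ⟨⟨fun _ => x, rfl, h, fun _ => hx, fun i => i.elim0⟩⟩⟩
    rintro ⟨f, hf⟩ ⟨f', hf'⟩
    apply Subtype.ext
    funext i
    have : i = 0 := by apply Fin.ext; have := i.2; simp only [Fin.val_zero]; omega
    rw [this]; simp only; rw [hf.1, hf'.1]
  · rw [Nat.card_eq_zero]
    left
    refine ⟨?_⟩
    rintro ⟨f, h0, h1, h2, h3⟩
    exact h (h0.symm.trans h1)

lemma nbr_mem (B : Set Z2) (x y : Z2) (hx : x ∈ B) (hb : x ∉ bdry B) (hxy : Adj x y) : y ∈ B := by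
  by_contra h
  exact hb ⟨hx, y, hxy, h⟩

lemma partial_le (N : ℕ) (y : Z2) (T : ℕ) : ∀ x ∈ V5N N,
    ∑ t ∈ Finset.range T, (1 / 4 : ℝ) ^ t * nWalks (V5N N) t x y
      ≤ 2 * (9 * (N : ℝ) ^ 2 - (x.1 : ℝ) ^ 2) := by
  have wnn : ∀ x ∈ V5N N, 0 ≤ 2 * (9 * (N : ℝ) ^ 2 - (x.1 : ℝ) ^ 2) := by
    rintro x ⟨h1, h2, -, -⟩
    have h1' : (-(2 * (N : ℝ))) ≤ x.1 := by exact_mod_cast h1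
    have h2' : (x.1 : ℝ) < 3 * N := by exact_mod_cast h2
    have : (0 : ℝ) ≤ N := by positivity
    nlinarith
  induction T with
  | zero => intro x hx; simpa using wnn x hx
  | succ T ih =>
    intro x hx
    by_cases hb : x ∈ bdry (V5N N)
    · simp only [nWalks_bdry _ _ _ _ hb]
      simpa using wnn x hx
    · rw [Finset.sum_range_succ']
      have e : ∑ t ∈ Finset.range T, (1 / 4 : ℝ) ^ (t + 1) * nWalks (V5N N) (t + 1) x y
          = 1 / 4 * nbS (fun x' => ∑ t ∈ Finset.range T, (1 / 4 : ℝ) ^ t * nWalks (V5N N) t x' y) x := by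
        simp only [nbS, ← Finset.sum_add_distrib, Finset.mul_sum]
        refine Finset.sum_congr rfl fun t _ => ?_
        rw [nWalks_succ _ _ _ _ hb]
        unfold nbS; ring
      rw [e]
      have z0 : (nWalks (V5N N) 0 x y : ℝ) ≤ 1 := by
        rw [nWalks_zero _ _ _ hb]; split_ifs <;> simp
      have mm : ∀ x' ∈ nbrs x, x' ∈ V5N N := fun x' hx' =>
        nbr_mem _ x x' hx hb ((mem_nbrs x x').mp hx')
      have i1 := ih (x.1 + 1, x.2) (mm _ (by simp [nbrs]))
      have i2 := ih (x.1 - 1, x.2) (mm _ (by simp [nbrs]))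
      have i3 := ih (x.1, x.2 + 1) (mm _ (by simp [nbrs]))
      have i4 := ih (x.1, x.2 - 1) (mm _ (by simp [nbrs]))
      unfold nbS
      push_cast at i1 i2 i3 i4
      rw [pow_zero, one_mul]
      nlinarith

lemma green_summable (N : ℕ) (x y : Z2) (hx : x ∈ V5N N) :
    Summable (fun t : ℕ => (1 / 4 : ℝ) ^ t * nWalks (V5N N) t x y) :=
  summable_of_sum_range_le (fun t => by positivity) (fun T => partial_le N y T x hx)

open Classical in
lemma green_step (N : ℕ) (x y : Z2) (hx : x ∈ V5N N) (hb : x ∉ bdry (V5N N)) :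
    4 * greenFn (V5N N) x y = nbS (fun x' => greenFn (V5N N) x' y) x + 4 * (if x = y then 1 else 0) := by
  have mm : ∀ x' ∈ nbrs x, x' ∈ V5N N := fun x' hx' =>
    nbr_mem _ x x' hx hb ((mem_nbrs x x').mp hx')
  have s1 := (green_summable N (x.1 + 1, x.2) y (mm _ (by simp [nbrs]))).hasSum
  have s2 := (green_summable N (x.1 - 1, x.2) y (mm _ (by simp [nbrs]))).hasSum
  have s3 := (green_summable N (x.1, x.2 + 1) y (mm _ (by simp [nbrs]))).hasSum
  have s4 := (green_summable N (x.1, x.2 - 1) y (mm _ (by simp [nbrs]))).hasSum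
  have s := (((s1.add s2).add s3).add s4).mul_left (1 / 4)
  have e : greenFn (V5N N) x y = (if x = y then 1 else 0) +
      1 / 4 * nbS (fun x' => greenFn (V5N N) x' y) x := by
    conv_lhs => unfold greenFn
    rw [(green_summable N x y hx).tsum_eq_zero_add, nWalks_zero _ _ _ hb]
    congr 1
    · simp
    · rw [show (1 / 4 * nbS (fun x' => greenFn (V5N N) x' y) x) = _ from s.tsum_eq.symm]
      refine tsum_congr fun t => ?_
      rw [nWalks_succ _ _ _ _ hb]
      unfold nbS; ring
  rw [e]; ring

lemma green_bdry (B : Set Z2) (x y : Z2) (h : x ∈ bdry B ∨ y ∈ bdry B) : greenFn B x y = 0 := by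
  unfold greenFn
  have : ∀ t, nWalks B t x y = 0 := fun t => h.elim (nWalks_bdry B t x y) (nWalks_bdry' B t x y)
  simp [this]

section prob
variable {Ω : Type} [MeasureSpace Ω]

lemma eta_memLp (N : ℕ) (η : Z2 → Ω → ℝ) (hη : IsDGFF (V5N N) η) (z : Z2) :
    MemLp (η z) 2 (ℙ : Measure Ω) := by
  obtain ⟨v, hv⟩ := hη.1 {z} (fun _ => 1)
  simp only [Finset.sum_singleton, one_mul] at hv
  have hm : AEMeasurable (η z) (ℙ : Measure Ω) := by
    by_contra h
    have h0 : Measure.map (fun ω => η z ω) (ℙ : Measure Ω) = 0 := Measure.map_of_not_aemeasurable h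
    rw [h0] at hv
    exact IsProbabilityMeasure.ne_zero _ hv.symm
  have h2 : MemLp id 2 (Measure.map (η z) (ℙ : Measure Ω)) := by
    have : Measure.map (η z) (ℙ : Measure Ω) = gaussianReal 0 v := hv
    rw [this]
    exact memLp_id_gaussianReal 2
  exact (memLp_map_measure_iff (by fun_prop) hm).mp h2

lemma cov_zero (N : ℕ) (η : Z2 → Ω → ℝ) (hη : IsDGFF (V5N N) η) (x y : Z2)
    (hx : x ∉ V5N N \ bdry (V5N N)) : ∫ ω, η x ω * η y ω = 0 := by
  by_cases h1 : x ∈ V5N N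
  · by_cases h2 : y ∈ V5N N
    · rw [hη.2.2 x h1 y h2]
      refine green_bdry _ _ _ (Or.inl ?_)
      by_contra h; exact hx ⟨h1, h⟩
    · simp [hη.2.1 y h2]
  · simp [hη.2.1 x h1]

open Classical in
lemma cov_step (N : ℕ) (η : Z2 → Ω → ℝ) (hη : IsDGFF (V5N N) η) (x y : Z2)
    (hx : x ∈ V5N N \ bdry (V5N N)) :
    4 * ∫ ω, η x ω * η y ω =
      nbS (fun x' => ∫ ω, η x' ω * η y ω) x + 4 * (if x = y then 1 else 0) := by
  by_cases h2 : y ∈ V5N N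
  · have mm : ∀ x' ∈ nbrs x, x' ∈ V5N N := fun x' hx' =>
      nbr_mem _ x x' hx.1 hx.2 ((mem_nbrs x x').mp hx')
    have := green_step N x y hx.1 hx.2
    simp only [nbS] at this ⊢
    rw [hη.2.2 x hx.1 y h2, hη.2.2 _ (mm (x.1 + 1, x.2) (by simp [nbrs])) y h2,
      hη.2.2 _ (mm (x.1 - 1, x.2) (by simp [nbrs])) y h2,
      hη.2.2 _ (mm (x.1, x.2 + 1) (by simp [nbrs])) y h2,
      hη.2.2 _ (mm (x.1, x.2 - 1) (by simp [nbrs])) y h2]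
    exact this
  · have : x ≠ y := fun h => h2 (h ▸ hx.1)
    simp [nbS, hη.2.1 y h2, this]

/-- The energy bound on the covariance with a linear functional. -/
lemma energy (N : ℕ) (η : Z2 → Ω → ℝ) (hη : IsDGFF (V5N N) η) (S : Finset Z2) (p : Z2 → ℝ)
    (a b : Z2 → Z2) : ∃ g : Z2 → ℝ,
    (∫ ω, (∑ z ∈ S, p z * (η (a z) ω - η (b z) ω)) ^ 2 = ∑ z ∈ S, p z * (g (a z) - g (b z))) ∧
    (∀ T : Finset Z2, ∑ x ∈ T, (g (x.1 + 1, x.2) - g x) ^ 2 ≤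
      4 * ∑ z ∈ S, p z * (g (a z) - g (b z))) ∧
    (∀ T : Finset Z2, ∑ x ∈ T, (g (x.1, x.2 + 1) - g x) ^ 2 ≤
      4 * ∑ z ∈ S, p z * (g (a z) - g (b z))) := by
  classical
  set K : Z2 → Z2 → ℝ := fun x y => ∫ ω, η x ω * η y ω with hK
  set g : Z2 → ℝ := fun x => ∑ z ∈ S, p z * (K x (a z) - K x (b z)) with hg
  have hprodInt : ∀ x y, Integrable (fun ω => η x ω * η y ω) (ℙ : Measure Ω) := fun x y =>
    (eta_memLp N η hη x).integrable_mul (eta_memLp N η hη y)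
  have hD : ∀ x, Integrable (fun ω => η x ω * ∑ z ∈ S, p z * (η (a z) ω - η (b z) ω)) (ℙ : Measure Ω)
      ∧ ∫ ω, η x ω * ∑ z ∈ S, p z * (η (a z) ω - η (b z) ω) = g x := by
    intro x
    have hi : ∀ z ∈ S, Integrable (fun ω => p z * (η x ω * η (a z) ω - η x ω * η (b z) ω)) (ℙ : Measure Ω) :=
      fun z _ => ((hprodInt x (a z)).sub (hprodInt x (b z))).const_mul (p z)
    have e : (fun ω => η x ω * ∑ z ∈ S, p z * (η (a z) ω - η (b z) ω)) =
        fun ω => ∑ z ∈ S, p z * (η x ω * η (a z) ω - η x ω * η (b z) ω) := by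
      funext ω; rw [Finset.mul_sum]; refine Finset.sum_congr rfl fun z _ => by ring
    rw [e]
    refine ⟨integrable_finsetSum _ hi, ?_⟩
    rw [integral_finsetSum _ hi]
    refine Finset.sum_congr rfl fun z _ => ?_
    rw [integral_const_mul, integral_sub (hprodInt x (a z)) (hprodInt x (b z))]
  have g0 : ∀ x, x ∉ V5N N \ bdry (V5N N) → g x = 0 := by
    intro x hx
    simp only [hg, hK, cov_zero N η hη x _ hx]; simp
  set VV : Finset Z2 := Finset.Ico (-(2 * (N : ℤ))) (3 * N) ×ˢ Finset.Ico (-(2 * (N : ℤ))) (3 * N)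
  have gV : ∀ x, x ∉ VV → g x = 0 := by
    intro x hx
    apply g0
    intro h
    obtain ⟨h1, h2, h3, h4⟩ := h.1
    exact hx (by simp [VV, h1, h2, h3, h4])
  have hlap : ∀ x, g x * (4 * g x - nbS g x) =
      ∑ z ∈ S, 4 * p z * ((if x = a z then g (a z) else 0) - (if x = b z then g (b z) else 0)) := by
    intro x
    by_cases hx : x ∈ V5N N \ bdry (V5N N)
    · have : 4 * g x - nbS g x =
          ∑ z ∈ S, 4 * p z * ((if x = a z then 1 else 0) - (if x = b z then 1 else 0)) := by
        simp only [hg, nbS, ← Finset.sum_add_distrib, Finset.mul_sum, ← Finset.sum_sub_distrib]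
        refine Finset.sum_congr rfl fun z _ => ?_
        have A := cov_step N η hη x (a z) hx
        have B := cov_step N η hη x (b z) hx
        unfold nbS at A B
        linear_combination p z * A - p z * B
      rw [this, Finset.mul_sum]
      refine Finset.sum_congr rfl fun z _ => ?_
      have q : ∀ y, (if x = y then g y else 0) = g x * (if x = y then 1 else 0) := by
        intro y; split_ifs with h
        · rw [h, mul_one]
        · simp
      rw [q, q]; ring
    · rw [g0 x hx, zero_mul, Finset.sum_eq_zero]
      intro z _
      have : ∀ y, (if x = y then g y else 0) = 0 := by
        intro y; split_ifs with h
        · rw [← h]; exact g0 x hx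
        · rfl
      rw [this, this]; simp
  have htsum : ∑' x, g x * (4 * g x - nbS g x) = 4 * ∑ z ∈ S, p z * (g (a z) - g (b z)) := by
    have hs : HasSum (fun x => ∑ z ∈ S, 4 * p z *
        ((if x = a z then g (a z) else 0) - (if x = b z then g (b z) else 0)))
        (∑ z ∈ S, 4 * p z * (g (a z) - g (b z))) := by
      refine hasSum_sum fun z _ => ?_
      exact ((hasSum_ite_eq (a z) (g (a z))).sub (hasSum_ite_eq (b z) (g (b z)))).mul_left _
    rw [tsum_congr hlap, hs.tsum_eq, Finset.mul_sum]
    refine Finset.sum_congr rfl fun z _ => by ring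
  refine ⟨g, ?_, ?_⟩
  · have e : (fun ω => (∑ z ∈ S, p z * (η (a z) ω - η (b z) ω)) ^ 2) = fun ω =>
        ∑ z' ∈ S, p z' * (η (a z') ω * (∑ z ∈ S, p z * (η (a z) ω - η (b z) ω)) -
          η (b z') ω * (∑ z ∈ S, p z * (η (a z) ω - η (b z) ω))) := by
      funext ω
      rw [sq, Finset.sum_mul]
      refine Finset.sum_congr rfl fun z _ => by ring
    have hi : ∀ z' ∈ S, Integrable (fun ω => p z' *
        (η (a z') ω * (∑ z ∈ S, p z * (η (a z) ω - η (b z) ω)) -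
          η (b z') ω * (∑ z ∈ S, p z * (η (a z) ω - η (b z) ω)))) (ℙ : Measure Ω) :=
      fun z _ => ((hD (a z)).1.sub (hD (b z)).1).const_mul (p z)
    rw [e, integral_finsetSum _ hi]
    refine Finset.sum_congr rfl fun z _ => ?_
    rw [integral_const_mul, integral_sub (hD (a z)).1 (hD (b z)).1, (hD (a z)).2, (hD (b z)).2]
  · have := parts g VV gV
    rw [htsum] at this
    exact this
lemma bound_of_sq (V h d : ℝ) (hV : 0 ≤ V) (hh : 0 < h) (hd : 0 ≤ d)
    (H : V ≤ 4 / h * (8 * √(3 * h * d * (4 * V)))) : V ≤ 12288 * d / h := by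
  have h0 : 0 ≤ 3 * h * d * (4 * V) := by positivity
  have h2 : V ^ 2 ≤ (4 / h * (8 * √(3 * h * d * (4 * V)))) ^ 2 := pow_le_pow_left₀ hV H 2
  have e : (4 / h * (8 * √(3 * h * d * (4 * V)))) ^ 2 = 12288 * d / h * V := by
    rw [mul_pow, mul_pow, Real.sq_sqrt h0]; field_simp; ring
  rw [e] at h2
  rcases hV.eq_or_lt with hz | hp
  · rw [← hz]; positivity
  · nlinarith

lemma sum_bound (S : Finset Z2) (p f : Z2 → ℝ) (c : ℝ) (hp : ∀ z ∈ S, |p z| ≤ c) :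
    ∑ z ∈ S, p z * f z ≤ c * ∑ z ∈ S, |f z| := by
  rw [Finset.mul_sum]
  refine Finset.sum_le_sum fun z hz => ?_
  refine (le_abs_self _).trans ?_
  rw [abs_mul]
  exact mul_le_mul_of_nonneg_right (hp z hz) (abs_nonneg _)

lemma hor_bound (N : ℕ) (η : Z2 → Ω → ℝ) (hη : IsDGFF (V5N N) η) (h : ℤ) (hh : 1 ≤ h)
    (p : Z2 → ℝ) (hp : ∀ z ∈ sph h, |p z| ≤ 4 / (h : ℝ)) (u : Z2) (d : ℕ) :
    ∫ ω, (∑ z ∈ sph h, p z *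
      (η (u.1 + z.1, u.2 + z.2) ω - η (u.1 + z.1 + d, u.2 + z.2) ω)) ^ 2 ≤ 12288 * d / (h : ℝ) := by
  obtain ⟨g, e0, e1, e2⟩ := energy N η hη (sph h) p (fun z => (u.1 + z.1, u.2 + z.2))
    (fun z => (u.1 + z.1 + d, u.2 + z.2))
  have hR : (1 : ℝ) ≤ h := by exact_mod_cast hh
  have hV : 0 ≤ ∫ ω, (∑ z ∈ sph h, p z *
      (η (u.1 + z.1, u.2 + z.2) ω - η (u.1 + z.1 + d, u.2 + z.2) ω)) ^ 2 :=
    integral_nonneg fun ω => sq_nonneg _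
  rw [e0] at hV ⊢
  refine bound_of_sq _ h d hV (by linarith) (by positivity) ?_
  refine (sum_bound _ p _ _ hp).trans ?_
  exact mul_le_mul_of_nonneg_left (key_hor g _ e1 e2 h hh d u) (by positivity)

lemma ver_bound (N : ℕ) (η : Z2 → Ω → ℝ) (hη : IsDGFF (V5N N) η) (h : ℤ) (hh : 1 ≤ h)
    (p : Z2 → ℝ) (hp : ∀ z ∈ sph h, |p z| ≤ 4 / (h : ℝ)) (u : Z2) (d : ℕ) :
    ∫ ω, (∑ z ∈ sph h, p z *
      (η (u.1 + z.1, u.2 + z.2) ω - η (u.1 + z.1, u.2 + z.2 + d) ω)) ^ 2 ≤ 12288 * d / (h : ℝ) := by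
  obtain ⟨g, e0, e1, e2⟩ := energy N η hη (sph h) p (fun z => (u.1 + z.1, u.2 + z.2))
    (fun z => (u.1 + z.1, u.2 + z.2 + d))
  have hR : (1 : ℝ) ≤ h := by exact_mod_cast hh
  have hV : 0 ≤ ∫ ω, (∑ z ∈ sph h, p z *
      (η (u.1 + z.1, u.2 + z.2) ω - η (u.1 + z.1, u.2 + z.2 + d) ω)) ^ 2 :=
    integral_nonneg fun ω => sq_nonneg _
  rw [e0] at hV ⊢
  refine bound_of_sq _ h d hV (by linarith) (by positivity) ?_
  refine (sum_bound _ p _ _ hp).trans ?_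
  exact mul_le_mul_of_nonneg_left (key_ver g _ e1 e2 h hh d u) (by positivity)

lemma sq_tri (X Y : Ω → ℝ) (hX : MemLp X 2 (ℙ : Measure Ω)) (hY : MemLp Y 2 (ℙ : Measure Ω)) :
    ∫ ω, (X ω + Y ω) ^ 2 ≤ 2 * (∫ ω, X ω ^ 2) + 2 * ∫ ω, Y ω ^ 2 := by
  have iX := hX.integrable_sq.const_mul 2
  have iY := hY.integrable_sq.const_mul 2
  rw [← integral_const_mul, ← integral_const_mul, ← integral_add iX iY]
  refine integral_mono (hX.add hY).integrable_sq (iX.add iY) fun ω => ?_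
  simp only [Pi.add_apply]
  nlinarith [sq_nonneg (X ω - Y ω)]

/-- The weighted average of the field over the sphere around `u`. -/
noncomputable def avgH (η : Z2 → Ω → ℝ) (h : ℤ) (p : Z2 → ℝ) (u : Z2) (ω : Ω) : ℝ :=
  ∑ z ∈ sph h, p z * η (u.1 + z.1, u.2 + z.2) ω

lemma avgH_memLp (N : ℕ) (η : Z2 → Ω → ℝ) (hη : IsDGFF (V5N N) η) (h : ℤ) (p : Z2 → ℝ) (u : Z2) :
    MemLp (avgH η h p u) 2 (ℙ : Measure Ω) := by
  unfold avgH
  exact memLp_finsetSum _ fun z _ => (eta_memLp N η hη _).const_mul (p z)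

lemma hor_avg (N : ℕ) (η : Z2 → Ω → ℝ) (hη : IsDGFF (V5N N) η) (h : ℤ) (hh : 1 ≤ h)
    (p : Z2 → ℝ) (hp : ∀ z ∈ sph h, |p z| ≤ 4 / (h : ℝ)) (a b c : ℤ) :
    ∫ ω, (avgH η h p (a, c) ω - avgH η h p (b, c) ω) ^ 2 ≤ 12288 * (|a - b| : ℤ) / (h : ℝ) := by
  wlog hab : a ≤ b generalizing a b
  · have := this b a (by omega)
    rw [abs_sub_comm]
    refine le_trans (le_of_eq ?_) this
    congr 1; funext ω; ring
  obtain ⟨d, rfl⟩ : ∃ d : ℕ, b = a + d := ⟨(b - a).toNat, by omega⟩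
  have := hor_bound N η hη h hh p hp (a, c) d
  have e : |a - (a + (d : ℤ))| = d := by simp
  rw [e]
  refine le_trans (le_of_eq ?_) this
  congr 1; funext ω
  simp only [avgH, ← Finset.sum_sub_distrib]
  congr 1
  refine Finset.sum_congr rfl fun z _ => ?_
  rw [show a + (d : ℤ) + z.1 = a + z.1 + d by ring]; ring

lemma ver_avg (N : ℕ) (η : Z2 → Ω → ℝ) (hη : IsDGFF (V5N N) η) (h : ℤ) (hh : 1 ≤ h)
    (p : Z2 → ℝ) (hp : ∀ z ∈ sph h, |p z| ≤ 4 / (h : ℝ)) (a b c : ℤ) :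
    ∫ ω, (avgH η h p (c, a) ω - avgH η h p (c, b) ω) ^ 2 ≤ 12288 * (|a - b| : ℤ) / (h : ℝ) := by
  wlog hab : a ≤ b generalizing a b
  · have := this b a (by omega)
    rw [abs_sub_comm]
    refine le_trans (le_of_eq ?_) this
    congr 1; funext ω; ring
  obtain ⟨d, rfl⟩ : ∃ d : ℕ, b = a + d := ⟨(b - a).toNat, by omega⟩
  have := ver_bound N η hη h hh p hp (c, a) d
  have e : |a - (a + (d : ℤ))| = d := by simp
  rw [e]
  refine le_trans (le_of_eq ?_) this
  congr 1; funext ω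
  simp only [avgH, ← Finset.sum_sub_distrib]
  congr 1
  refine Finset.sum_congr rfl fun z _ => ?_
  rw [show a + (d : ℤ) + z.2 = a + z.2 + d by ring]; ring

lemma avg_bound (N : ℕ) (η : Z2 → Ω → ℝ) (hη : IsDGFF (V5N N) η) (h : ℤ) (hh : 1 ≤ h)
    (p : Z2 → ℝ) (hp : ∀ z ∈ sph h, |p z| ≤ 4 / (h : ℝ)) (u v : Z2) :
    ∫ ω, (avgH η h p u ω - avgH η h p v ω) ^ 2 ≤ 98304 * (linf u v : ℝ) / (2 * h : ℝ) := by
  obtain ⟨a, c⟩ := u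
  obtain ⟨b, d⟩ := v
  have m := avgH_memLp N η hη h p
  have t := sq_tri (fun ω => avgH η h p (a, c) ω - avgH η h p (b, c) ω)
    (fun ω => avgH η h p (b, c) ω - avgH η h p (b, d) ω) ((m _).sub (m _)) ((m _).sub (m _))
  have e : ∀ ω, avgH η h p (a, c) ω - avgH η h p (b, c) ω +
      (avgH η h p (b, c) ω - avgH η h p (b, d) ω) =
      avgH η h p (a, c) ω - avgH η h p (b, d) ω := fun ω => by ring
  simp only [e] at t
  have q1 := hor_avg N η hη h hh p hp a b c
  have q2 := ver_avg N η hη h hh p hp c d b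
  have hR : (1 : ℝ) ≤ h := by exact_mod_cast hh
  have l1 : ((|a - b| : ℤ) : ℝ) ≤ (linf (a, c) (b, d) : ℝ) := by
    exact_mod_cast le_max_left _ _
  have l2 : ((|c - d| : ℤ) : ℝ) ≤ (linf (a, c) (b, d) : ℝ) := by
    exact_mod_cast le_max_right _ _
  have r1 : 12288 * ((|a - b| : ℤ) : ℝ) / (h : ℝ) ≤ 12288 * (linf (a, c) (b, d) : ℝ) / h := by
    gcongr
  have r2 : 12288 * ((|c - d| : ℤ) : ℝ) / (h : ℝ) ≤ 12288 * (linf (a, c) (b, d) : ℝ) / h := by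
    gcongr
  have : 98304 * (linf (a, c) (b, d) : ℝ) / (2 * h : ℝ) =
      4 * (12288 * (linf (a, c) (b, d) : ℝ) / h) := by
    field_simp; ring
  rw [this]
  linarith

lemma H_eq_avg (η : Z2 → Ω → ℝ) (h : ℤ) (hh : 1 ≤ h) (p : Z2 → ℝ)
    (hp : ∀ F : Z2 → ℝ, (∀ z ∈ intB h, 4 * F z = nbS F z) → F (0, 0) = ∑ z ∈ sph h, p z * F z)
    (u : Z2) (F : Z2 → Ω → ℝ) (hF : IsHarmExt η F (boxZ u (2 * h))) : F u = avgH η h p u := by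
  have hdiv : 2 * h / 2 = h := by omega
  have hin : ∀ z ∈ intB h, (u.1 + z.1, u.2 + z.2) ∈ boxZ u (2 * h) \ bdry (boxZ u (2 * h)) := by
    intro z hz
    rw [mem_intB] at hz
    have key : ∀ w ∈ nbrs (u.1 + z.1, u.2 + z.2), w ∈ boxZ u (2 * h) := by
      intro w hw
      simp only [nbrs, Finset.mem_insert, Finset.mem_singleton] at hw
      rcases hw with rfl | rfl | rfl | rfl <;> simp only [boxZ, hdiv, Set.mem_setOf_eq] <;> omega
    refine ⟨?_, ?_⟩
    · simp only [boxZ, hdiv, Set.mem_setOf_eq]; omega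
    · rintro ⟨_, w, hw, hw'⟩
      exact hw' (key w ((mem_nbrs _ _).mpr hw))
  have hout : ∀ z ∈ sph h, (u.1 + z.1, u.2 + z.2) ∉ boxZ u (2 * h) \ bdry (boxZ u (2 * h)) := by
    intro z hz hc
    rw [mem_sph, mem_bigB, mem_intB] at hz
    have key : ∀ w ∈ nbrs (u.1 + z.1, u.2 + z.2), w ∈ boxZ u (2 * h) := fun w hw =>
      nbr_mem _ _ w hc.1 hc.2 ((mem_nbrs _ _).mp hw)
    have k1 := key (u.1 + z.1 + 1, u.2 + z.2) (by simp [nbrs])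
    have k2 := key (u.1 + z.1 - 1, u.2 + z.2) (by simp [nbrs])
    have k3 := key (u.1 + z.1, u.2 + z.2 + 1) (by simp [nbrs])
    have k4 := key (u.1 + z.1, u.2 + z.2 - 1) (by simp [nbrs])
    simp only [boxZ, hdiv, Set.mem_setOf_eq] at k1 k2 k3 k4
    omega
  funext ω
  have := hp (fun z => F (u.1 + z.1, u.2 + z.2) ω) (by
    intro z hz
    have := hF.2 _ (hin z hz) ω
    simp only [nbS]
    simpa only [add_assoc, add_sub_assoc] using this)
  simp only [add_zero] at this
  rw [this]
  unfold avgH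
  refine Finset.sum_congr rfl fun z hz => ?_
  rw [hF.1 _ (hout z hz)]

end prob

/-- **Lemma 2.2.** There is a universal constant `C₅ > 0` such that for `K = 2^k`,
`K^m ≤ N < K^{m+1}`, `u, v ∈ V_N` with `|u - v|_∞ ≤ K^j`:
`E[(H_{K^j}(u) - H_{K^j}(v))²] ≤ C₅ |u-v|_∞ / K^j` for `1 ≤ j ≤ m`, and
`E[(η_j(u) - η_j(v))²] ≤ C₅ |u-v|_∞ / K^j` for `1 ≤ j ≤ m-1`. -/
theorem harmonic_extension_increment_bound :
    ∃ C₅ : ℝ, 0 < C₅ ∧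
      ∀ k : ℕ, 1 ≤ k → ∀ K : ℕ, K = 2 ^ k →
        ∀ m N : ℕ, K ^ m ≤ N → N < K ^ (m + 1) →
          ∀ (Ω : Type) (_ : MeasureSpace Ω), IsProbabilityMeasure (ℙ : Measure Ω) →
            ∀ η : Z2 → Ω → ℝ, IsDGFF (V5N N) η →
              ∀ H : ℤ → Z2 → Ω → ℝ,
                (∀ (r : ℕ) (x : Z2), ∃ F : Z2 → Ω → ℝ,
                  IsHarmExt η F (boxZ x ((K : ℤ) ^ r)) ∧ H ((K : ℤ) ^ r) x = F x) →
                (∀ j : ℕ, 1 ≤ j → j ≤ m →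
                  ∀ u ∈ VN N, ∀ v ∈ VN N, linf u v ≤ (K : ℤ) ^ j →
                    ∫ ω, (H ((K : ℤ) ^ j) u ω - H ((K : ℤ) ^ j) v ω) ^ 2 ≤
                      C₅ * (linf u v : ℝ) / (K : ℝ) ^ j) ∧
                (∀ j : ℕ, 1 ≤ j → j < m →
                  ∀ u ∈ VN N, ∀ v ∈ VN N, linf u v ≤ (K : ℤ) ^ j →
                    ∫ ω, (etaJ η H K j u ω - etaJ η H K j v ω) ^ 2 ≤
                      C₅ * (linf u v : ℝ) / (K : ℝ) ^ j) := by
  refine ⟨393216, by norm_num, ?_⟩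
  intro k hk K hK m N _ _ Ω mΩ hprob η hη H hH
  have half : ∀ j : ℕ, 1 ≤ j → ∃ h : ℤ, 1 ≤ h ∧ (K : ℤ) ^ j = 2 * h := by
    intro j hj
    obtain ⟨k', rfl⟩ : ∃ k', k = k' + 1 := ⟨k - 1, by omega⟩
    obtain ⟨j', rfl⟩ : ∃ j', j = j' + 1 := ⟨j - 1, by omega⟩
    refine ⟨2 ^ k' * (K : ℤ) ^ j', ?_, ?_⟩
    · have : (0 : ℤ) < 2 ^ k' * (K : ℤ) ^ j' := by rw [hK]; positivity
      omega
    · rw [hK]; push_cast; ring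
  have main : ∀ j : ℕ, 1 ≤ j → (∀ u, MemLp (H ((K : ℤ) ^ j) u) 2 (ℙ : Measure Ω)) ∧ ∀ u v : Z2,
      ∫ ω, (H ((K : ℤ) ^ j) u ω - H ((K : ℤ) ^ j) v ω) ^ 2 ≤
        98304 * (linf u v : ℝ) / (K : ℝ) ^ j := by
    intro j hj
    obtain ⟨h, hh, hKj⟩ := half j hj
    obtain ⟨p, hp1, hp2⟩ := harmMeas h hh
    have hu : ∀ u, H ((K : ℤ) ^ j) u = avgH η h p u := by
      intro u
      obtain ⟨F, hF, hF'⟩ := hH j u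
      rw [hF']
      rw [hKj] at hF
      exact H_eq_avg η h hh p hp2 u F hF
    have hKr : (K : ℝ) ^ j = 2 * (h : ℝ) := by exact_mod_cast hKj
    refine ⟨fun u => hu u ▸ avgH_memLp N η hη h p u, fun u v => ?_⟩
    rw [hu, hu, hKr]
    exact avg_bound N η hη h hh p hp1 u v
  have hK1 : (1 : ℝ) ≤ K := by
    have : 1 ≤ K := by rw [hK]; exact Nat.one_le_two_pow
    exact_mod_cast this
  have hl : ∀ u v : Z2, (0 : ℝ) ≤ (linf u v : ℝ) := by
    intro u v
    have : 0 ≤ linf u v := le_max_of_le_left (abs_nonneg _)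
    exact_mod_cast this
  constructor
  · intro j hj _ u _ v _ _
    refine ((main j hj).2 u v).trans ?_
    have := hl u v
    gcongr
    norm_num
  · intro j hj _ u _ v _ _
    have M1 := main j hj
    have M2 := main (j + 1) (by omega)
    have hj0 : j ≠ 0 := by omega
    have t := sq_tri (fun ω => H ((K : ℤ) ^ j) u ω - H ((K : ℤ) ^ j) v ω)
      (fun ω => H ((K : ℤ) ^ (j + 1)) v ω - H ((K : ℤ) ^ (j + 1)) u ω)
      ((M1.1 u).sub (M1.1 v)) ((M2.1 v).sub (M2.1 u))
    have e : ∀ ω, etaJ η H K j u ω - etaJ η H K j v ω =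
        H ((K : ℤ) ^ j) u ω - H ((K : ℤ) ^ j) v ω +
        (H ((K : ℤ) ^ (j + 1)) v ω - H ((K : ℤ) ^ (j + 1)) u ω) := by
      intro ω
      simp only [etaJ, hj0, if_false]; ring
    simp only [e]
    refine t.trans ?_
    have b1 := M1.2 u v
    have b2 := M2.2 v u
    have hsym : linf v u = linf u v := by
      unfold linf; rw [abs_sub_comm v.1, abs_sub_comm v.2]
    rw [hsym] at b2
    have hluv := hl u v
    have b3 : 98304 * (linf u v : ℝ) / (K : ℝ) ^ (j + 1) ≤ 98304 * (linf u v : ℝ) / (K : ℝ) ^ j := by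
      have : (K : ℝ) ^ j ≤ (K : ℝ) ^ (j + 1) := pow_le_pow_right₀ hK1 (by omega)
      gcongr
    have b4 : 393216 * (linf u v : ℝ) / (K : ℝ) ^ j = 4 * (98304 * (linf u v : ℝ) / (K : ℝ) ^ j) := by
      ring
    rw [b4]
    linarith
end

section
/- For all sufficiently large K = 2^k, all κ ∈ (0,1), and all N with K^m ≤ N < K^{m+1} and ⌊κN/K^{m−1}⌋ ≥ 1, every path P with ‖P‖ ≥ κN admits d₀ = ⌊κN/K^{m−1}⌋ pairwise disjoint subpaths P^{(1)}, …, P^{(d₀)} ∈ SL_{m−1} such that ‖P^{(i)}‖ = K^{m−1} and P^{(i)} ⊆ B(x_{P^{(i)}}, K^{m−1}) for each i, and every box in BD_{K^{m−1}} is visited by at most 12 of the subpaths. -/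
open MeasureTheory ProbabilityTheory Real Set Filter

/-- A lattice path viewed as a continuous curve in ℝ², parametrized at unit speed
along the unit edges of ℤ², allowed to start and end at interior points of edges.
`v n` is the lattice vertex occupied at integer time `n`; the curve is defined on
the time interval `[a, b]`, and consecutive vertices are nearest neighbors. -/
structure GridPath where
  a : ℝ
  b : ℝ
  hab : a ≤ b
  v : ℤ → Z2
  adj : ∀ n : ℤ, a < (n : ℝ) + 1 → (n : ℝ) < b → Adj (v n) (v (n + 1))

/-- The point of the curve at time `t` (affine interpolation along edges). -/
noncomputable def GridPath.pt (P : GridPath) (t : ℝ) : ℝ × ℝ :=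
  (((P.v ⌊t⌋).1 : ℝ) + (t - ⌊t⌋) * (((P.v (⌊t⌋ + 1)).1 : ℝ) - ((P.v ⌊t⌋).1 : ℝ)),
   ((P.v ⌊t⌋).2 : ℝ) + (t - ⌊t⌋) * (((P.v (⌊t⌋ + 1)).2 : ℝ) - ((P.v ⌊t⌋).2 : ℝ)))

/-- The starting point `x_P` of the path. -/
noncomputable def GridPath.start (P : GridPath) : ℝ × ℝ := P.pt P.a

/-- The ending point `y_P` of the path. -/
noncomputable def GridPath.fin (P : GridPath) : ℝ × ℝ := P.pt P.b

/-- The image (trace) of the path in ℝ². -/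
noncomputable def GridPath.image (P : GridPath) : Set (ℝ × ℝ) := P.pt '' Set.Icc P.a P.b

/-- Euclidean distance on ℝ². -/
noncomputable def e2 (p q : ℝ × ℝ) : ℝ := Real.sqrt ((p.1 - q.1) ^ 2 + (p.2 - q.2) ^ 2)

/-- `‖P‖`, the Euclidean distance between the endpoints of `P`. -/
noncomputable def GridPath.norm (P : GridPath) : ℝ := e2 P.start P.fin

/-- The closed Euclidean ball `B(c, r)` in ℝ². -/
def cball (c : ℝ × ℝ) (r : ℝ) : Set (ℝ × ℝ) := {p | e2 c p ≤ r}

/-- A lattice point of ℤ² as a point of ℝ². -/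
def castZ (z : Z2) : ℝ × ℝ := ((z.1 : ℝ), (z.2 : ℝ))

/-- The set of lattice points visited by the path. -/
noncomputable def GridPath.lattice (P : GridPath) : Set Z2 := {z | castZ z ∈ P.image}

/-- `Q` is a subpath of `P`. -/
def SubPath (Q P : GridPath) : Prop :=
  P.a ≤ Q.a ∧ Q.b ≤ P.b ∧ ∀ t ∈ Set.Icc Q.a Q.b, Q.pt t = P.pt t

/-- Two paths are disjoint if, after removing their endpoints, their traces are
disjoint subsets of ℝ². -/
def PathDisj (P Q : GridPath) : Prop :=
  (P.image \ {P.start, P.fin}) ∩ (Q.image \ {Q.start, Q.fin}) = ∅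

/-- The class `SL_j` of paths in scale `K^j` (for `1 ≤ j ≤ m-1`):
`K^j ≤ ‖P‖ ≤ (1 + 1/K) K^j` and `P ⊆ B(x_P, ‖P‖)`. -/
def SL (K j : ℕ) : Set GridPath :=
  {P | (K : ℝ) ^ j ≤ P.norm ∧ P.norm ≤ (1 + 1 / (K : ℝ)) * (K : ℝ) ^ j ∧
    P.image ⊆ cball P.start P.norm}

/-- The closed box of `BD_r` indexed by `(i₁, i₂) ∈ ℤ²`:
`[i₁ r - 1/2, (i₁+1) r - 1/2] × [i₂ r - 1/2, (i₂+1) r - 1/2]`. -/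
def BDbox (r : ℝ) (i : Z2) : Set (ℝ × ℝ) :=
  {p | (i.1 : ℝ) * r - 1 / 2 ≤ p.1 ∧ p.1 ≤ ((i.1 : ℝ) + 1) * r - 1 / 2 ∧
       (i.2 : ℝ) * r - 1 / 2 ≤ p.2 ∧ p.2 ≤ ((i.2 : ℝ) + 1) * r - 1 / 2}

/-- The ellipse `E(P) = {z : ‖x_P - z‖ + ‖y_P - z‖ ≤ (1 + 2/K²) ‖P‖}`. -/
noncomputable def ellipse (K : ℕ) (P : GridPath) : Set (ℝ × ℝ) :=
  {z | e2 P.start z + e2 P.fin z ≤ (1 + 2 / (K : ℝ) ^ 2) * P.norm}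

/-- A path `P ∈ SL_{j+1}` is tame if `P ⊆ Ẽ(P)`, where `Ẽ(P)` is the closed
`4 K^j`-neighborhood of the (compact) ellipse `E(P)`. -/
noncomputable def Tame (K j : ℕ) (P : GridPath) : Prop :=
  ∀ p ∈ P.image, ∃ w ∈ ellipse K P, e2 p w ≤ 4 * (K : ℝ) ^ j

theorem e2_eq_dist (p q : ℝ × ℝ) : e2 p q = dist (⟨p.1, p.2⟩ : ℂ) (⟨q.1, q.2⟩ : ℂ) := by
  rw [Complex.dist_eq_re_im]; rfl

theorem e2_tri (p q s : ℝ × ℝ) : e2 p s ≤ e2 p q + e2 q s := by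
  simp only [e2_eq_dist]; exact dist_triangle _ _ _

theorem e2_self (p : ℝ × ℝ) : e2 p p = 0 := by
  simp only [e2_eq_dist]; exact dist_self _

theorem continuous_interp (u : ℤ → ℝ) :
    Continuous (fun t : ℝ => u ⌊t⌋ + (t - ⌊t⌋) * (u (⌊t⌋ + 1) - u ⌊t⌋)) := by
  have hlf : LocallyFinite (fun n : ℤ => Set.Icc (n : ℝ) ((n : ℝ) + 1)) := by
    intro t
    refine ⟨Set.Ioo (t - 1) (t + 1), Ioo_mem_nhds (by linarith) (by linarith), ?_⟩
    refine (Set.finite_Icc (⌊t⌋ - 2) (⌊t⌋ + 2)).subset ?_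
    rintro n ⟨x, ⟨h1, h2⟩, h3, h4⟩
    have h5 := Int.floor_le t
    have h6 := Int.lt_floor_add_one t
    constructor
    · have : ((⌊t⌋ - 2 : ℤ) : ℝ) ≤ n := by push_cast; linarith
      exact_mod_cast this
    · have : (n : ℝ) ≤ ((⌊t⌋ + 2 : ℤ) : ℝ) := by push_cast; linarith
      exact_mod_cast this
  refine hlf.continuous ?_ (fun n => isClosed_Icc) ?_
  · refine Set.eq_univ_of_forall fun t => Set.mem_iUnion.2 ⟨⌊t⌋, Int.floor_le t, ?_⟩
    exact (Int.lt_floor_add_one t).le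
  · intro n
    have : ContinuousOn (fun t : ℝ => u n + (t - n) * (u (n + 1) - u n))
        (Set.Icc (n : ℝ) ((n : ℝ) + 1)) := by fun_prop
    refine this.congr ?_
    rintro t ⟨h1, h2⟩
    rcases h2.lt_or_eq with h | h
    · have : ⌊t⌋ = n := Int.floor_eq_iff.2 ⟨h1, h⟩
      simp only [this]
    · have : ⌊t⌋ = n + 1 := by
        rw [Int.floor_eq_iff]; push_cast; constructor <;> linarith
      simp only [this]
      push_cast
      rw [h]; ring

theorem GridPath.continuous_pt (P : GridPath) : Continuous P.pt :=
  (continuous_interp fun n => ((P.v n).1 : ℝ)).prodMk (continuous_interp fun n => ((P.v n).2 : ℝ))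

theorem continuous_e2 (P : GridPath) (p : ℝ × ℝ) : Continuous (fun t => e2 p (P.pt t)) := by
  have := P.continuous_pt
  have h1 : Continuous fun t => (P.pt t).1 := continuous_fst.comp this
  have h2 : Continuous fun t => (P.pt t).2 := continuous_snd.comp this
  exact (((continuous_const.sub h1).pow 2).add ((continuous_const.sub h2).pow 2)).sqrt

theorem exists_first {g : ℝ → ℝ} (hg : Continuous g) {a b c : ℝ} (hab : a ≤ b)
    (ha : g a ≤ c) (hb : c ≤ g b) :
    ∃ t ∈ Set.Icc a b, g t = c ∧ ∀ u ∈ Set.Icc a b, u < t → g u < c := by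
  have hne : (Set.Icc a b ∩ g ⁻¹' {c}).Nonempty := by
    obtain ⟨t, ht, h⟩ := intermediate_value_Icc hab hg.continuousOn ⟨ha, hb⟩
    exact ⟨t, ht, h⟩
  have hc : IsCompact (Set.Icc a b ∩ g ⁻¹' {c}) :=
    isCompact_Icc.inter_right (isClosed_singleton.preimage hg)
  obtain ⟨t, ⟨ht, htc⟩, hmin⟩ := hc.exists_isLeast hne
  refine ⟨t, ht, htc, fun u hu hut => ?_⟩
  by_contra hcu
  push Not at hcu
  obtain ⟨w, hw, h⟩ := intermediate_value_Icc hu.1 hg.continuousOn ⟨ha, hcu⟩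
  have := hmin ⟨⟨hw.1, hw.2.trans hu.2⟩, h⟩
  linarith [hw.2]

theorem exists_last {g : ℝ → ℝ} (hg : Continuous g) {a b c : ℝ} (hab : a ≤ b)
    (ha : g a ≤ c) (hb : c ≤ g b) :
    ∃ t ∈ Set.Icc a b, g t = c ∧ ∀ u ∈ Set.Icc a b, t < u → c < g u := by
  obtain ⟨t, ht, h1, h2⟩ := exists_first (g := fun x => - g (-x)) (by fun_prop)
    (a := -b) (b := -a) (c := -c) (by linarith) (by simpa using hb) (by simpa using ha)
  refine ⟨-t, ⟨by linarith [ht.2], by linarith [ht.1]⟩, by linarith, fun u hu hut => ?_⟩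
  have := h2 (-u) ⟨by linarith [hu.2], by linarith [hu.1]⟩ (by linarith)
  simp only [neg_neg] at this
  linarith

theorem exists_piece (P : GridPath) (r : ℝ) (hr : 0 < r) (i : ℕ)
    (h : ((i : ℝ) + 1) * r ≤ P.norm) :
    ∃ Q : GridPath, SubPath Q P ∧ Q.norm = r ∧ Q.image ⊆ cball Q.start r ∧
      (∀ p ∈ Q.image, (i : ℝ) * r ≤ e2 P.start p ∧ e2 P.start p ≤ ((i : ℝ) + 1) * r) ∧
      (∀ p ∈ Q.image \ {Q.start, Q.fin},
        (i : ℝ) * r < e2 P.start p ∧ e2 P.start p < ((i : ℝ) + 1) * r) := by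
  have hf := continuous_e2 P P.start
  have h0 : e2 P.start (P.pt P.a) = 0 := e2_self _
  have hi : (0 : ℝ) ≤ i := Nat.cast_nonneg i
  obtain ⟨t0, ht0, ht0c, ht0f⟩ := exists_first hf (c := ((i : ℝ) + 1) * r) P.hab
    (by rw [h0]; positivity) h
  obtain ⟨s, hs, hsc, hsl⟩ := exists_last hf (c := (i : ℝ) * r) ht0.1
    (by rw [h0]; positivity) (by rw [ht0c]; nlinarith)
  have hg := continuous_e2 P (P.pt s)
  obtain ⟨t, ht, htc, htf⟩ := exists_first hg (c := r) hs.2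
    (by rw [e2_self]; exact hr.le)
    (by have := e2_tri P.start (P.pt s) (P.pt t0); nlinarith)
  have hopen : ∀ u, s < u → u < t → (i : ℝ) * r < e2 P.start (P.pt u) ∧
      e2 P.start (P.pt u) < ((i : ℝ) + 1) * r := by
    intro u h1 h2
    exact ⟨hsl u ⟨by linarith [hs.1], by linarith [ht.2]⟩ h1,
      ht0f u ⟨by linarith [hs.1], by linarith [ht.2, ht0.2]⟩ (by linarith [ht.2])⟩
  refine ⟨⟨s, t, ht.1, P.v, fun n h1 h2 => P.adj n (by linarith [hs.1])
    (by linarith [ht.2, ht0.2])⟩, ⟨hs.1, ht.2.trans ht0.2, fun _ _ => rfl⟩, htc, ?_, ?_, ?_⟩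
  · rintro _ ⟨u, ⟨h1, h2⟩, rfl⟩
    show e2 (P.pt s) (P.pt u) ≤ r
    rcases h2.lt_or_eq with h2 | h2
    · exact (htf u ⟨h1, by linarith [ht.2]⟩ h2).le
    · rw [h2, htc]
  · rintro _ ⟨u, ⟨h1, h2⟩, rfl⟩
    show (i : ℝ) * r ≤ e2 P.start (P.pt u) ∧ e2 P.start (P.pt u) ≤ ((i : ℝ) + 1) * r
    change s ≤ u at h1
    change u ≤ t at h2
    constructor
    · rcases h1.lt_or_eq with h1 | h1
      · exact (hsl u ⟨by linarith [hs.1], by linarith [ht.2]⟩ h1).le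
      · rw [← h1, hsc]
    · rcases (h2.trans ht.2).lt_or_eq with h3 | h3
      · exact (ht0f u ⟨by linarith [hs.1], by linarith [ht0.2]⟩ h3).le
      · rw [h3, ht0c]
  · rintro _ ⟨⟨u, ⟨h1, h2⟩, rfl⟩, hne⟩
    change s ≤ u at h1
    change u ≤ t at h2
    refine hopen u (lt_of_le_of_ne h1 ?_) (lt_of_le_of_ne h2 ?_)
    · rintro rfl; exact hne (Or.inl rfl)
    · rintro rfl; exact hne (Or.inr rfl)

theorem e2_box {r : ℝ} (hr : 0 < r) {idx : Z2} {p q : ℝ × ℝ} (hp : p ∈ BDbox r idx)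
    (hq : q ∈ BDbox r idx) : e2 p q ≤ 2 * r := by
  obtain ⟨a1, a2, a3, a4⟩ := hp
  obtain ⟨b1, b2, b3, b4⟩ := hq
  unfold e2
  rw [Real.sqrt_le_left (by positivity)]
  have h1 : (p.1 - q.1) ^ 2 ≤ r ^ 2 := sq_le_sq' (by linarith) (by linarith)
  have h2 : (p.2 - q.2) ^ 2 ≤ r ^ 2 := sq_le_sq' (by linarith) (by linarith)
  nlinarith

/-- **Corollary 3.2 (i).** For all sufficiently large `K = 2^k`, every `κ ∈ (0,1)`,
and `K^m ≤ N < K^{m+1}` with `d₀ = ⌊κN/K^{m-1}⌋ ≥ 1`, every path `P` with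
`‖P‖ ≥ κN` admits `d₀` pairwise disjoint subpaths in `SL_{m-1}`, each of distance
exactly `K^{m-1}`, contained in the ball of radius `K^{m-1}` about its starting
point, and such that every box of `BD_{K^{m-1}}` is visited by at most 12 of them. -/
theorem extract_subpaths_top_scale :
    ∃ K₀ : ℕ, ∀ k K : ℕ, K = 2 ^ k → K₀ ≤ K →
      ∀ κ : ℝ, 0 < κ → κ < 1 →
        ∀ m N : ℕ, K ^ m ≤ N → N < K ^ (m + 1) →
          1 ≤ (⌊κ * (N : ℝ) / (K : ℝ) ^ (m - 1)⌋).toNat →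
            ∀ P : GridPath, κ * N ≤ P.norm →
              ∃ Q : Fin (⌊κ * (N : ℝ) / (K : ℝ) ^ (m - 1)⌋).toNat → GridPath,
                (∀ i, SubPath (Q i) P ∧ Q i ∈ SL K (m - 1) ∧
                  (Q i).norm = (K : ℝ) ^ (m - 1) ∧
                  (Q i).image ⊆ cball (Q i).start ((K : ℝ) ^ (m - 1))) ∧
                (∀ i i', i ≠ i' → PathDisj (Q i) (Q i')) ∧
                (∀ idx : Z2,
                  Nat.card {i // ((Q i).image ∩ BDbox ((K : ℝ) ^ (m - 1)) idx).Nonempty}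
                    ≤ 12) := by
  refine ⟨1, ?_⟩
  intro k K _ hK κ hκ0 hκ1 m N _ _ hd P hP
  have hK0 : (0 : ℝ) < K := by exact_mod_cast hK
  have hr : (0 : ℝ) < (K : ℝ) ^ (m - 1) := by positivity
  generalize hrK : (K : ℝ) ^ (m - 1) = r at *
  have hdr : ((⌊κ * (N : ℝ) / r⌋.toNat : ℕ) : ℝ) * r ≤ P.norm := by
    have h1 : ((⌊κ * (N : ℝ) / r⌋.toNat : ℕ) : ℝ) ≤ κ * N / r := by
      have h2 : ((⌊κ * (N : ℝ) / r⌋.toNat : ℕ) : ℤ) = ⌊κ * (N : ℝ) / r⌋ := by omega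
      have h3 : ((⌊κ * (N : ℝ) / r⌋.toNat : ℕ) : ℝ) = ((⌊κ * (N : ℝ) / r⌋ : ℤ) : ℝ) := by
        exact_mod_cast congrArg (Int.cast : ℤ → ℝ) h2
      rw [h3]
      exact Int.floor_le _
    rw [le_div_iff₀ hr] at h1
    linarith
  generalize ⌊κ * (N : ℝ) / r⌋.toNat = d at *
  have hex : ∀ i : Fin d, _ := fun i => exists_piece P r hr i (by
    refine le_trans ?_ hdr
    have : ((i : ℕ) : ℝ) + 1 ≤ d := by exact_mod_cast i.2
    nlinarith)
  choose Q hsub hnorm hball hcl hop using hex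
  refine ⟨Q, fun i => ⟨hsub i, ⟨by rw [hrK, hnorm i], ?_, ?_⟩, hnorm i, hball i⟩, ?_, ?_⟩
  · rw [hnorm i, hrK]
    have : 0 ≤ 1 / (K : ℝ) := by positivity
    nlinarith
  · rw [hnorm i]; exact hball i
  · have key : ∀ i j : Fin d, i < j → ∀ p, p ∈ (Q i).image \ {(Q i).start, (Q i).fin} →
        p ∈ (Q j).image \ {(Q j).start, (Q j).fin} → False := by
      intro i j hij p h1 h2
      have a1 := (hop i p h1).2
      have a2 := (hop j p h2).1
      have : ((i : ℕ) : ℝ) + 1 ≤ ((j : ℕ) : ℝ) := by exact_mod_cast hij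
      nlinarith
    intro i j hij
    refine Set.eq_empty_iff_forall_notMem.2 ?_
    rintro p ⟨h1, h2⟩
    rcases lt_or_gt_of_ne hij with h | h
    · exact key i j h p h1 h2
    · exact key j i h p h2 h1
  · intro idx
    have hclose : ∀ i j : Fin d, ((Q i).image ∩ BDbox r idx).Nonempty →
        ((Q j).image ∩ BDbox r idx).Nonempty → (j : ℕ) ≤ i + 3 := by
      rintro i j ⟨p, hp, hpb⟩ ⟨q, hq, hqb⟩
      have a1 := (hcl i p hp).2
      have a2 := (hcl j q hq).1
      have a3 := e2_box hr hpb hqb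
      have a4 := e2_tri P.start p q
      have a5 : ((j : ℕ) : ℝ) * r ≤ (((i : ℕ) : ℝ) + 3) * r := by linarith
      have a6 := le_of_mul_le_mul_right a5 hr
      exact_mod_cast a6
    by_contra hcon
    push Not at hcon
    let S : Finset (Fin d) := by
      classical exact Finset.univ.filter fun i => ((Q i).image ∩ BDbox r idx).Nonempty
    have hmem : ∀ i, i ∈ S ↔ ((Q i).image ∩ BDbox r idx).Nonempty := by
      intro i; simp [S]
    have hcard : Nat.card {i // ((Q i).image ∩ BDbox r idx).Nonempty} = S.card := by
      rw [← Nat.card_eq_finsetCard]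
      exact Nat.card_congr (Equiv.subtypeEquivRight fun i => (hmem i).symm)
    rw [hcard] at hcon
    have hne : S.Nonempty := Finset.card_pos.1 (by omega)
    have hmin := S.min'_mem hne
    have hsubset : S.image Fin.val ⊆ Finset.Icc (S.min' hne : ℕ) (S.min' hne + 3) := by
      intro n hn
      obtain ⟨j, hj, rfl⟩ := Finset.mem_image.1 hn
      exact Finset.mem_Icc.2 ⟨S.min'_le j hj, hclose _ _ ((hmem _).1 hmin) ((hmem _).1 hj)⟩
    have hle := Finset.card_le_card hsubset
    rw [Finset.card_image_of_injective _ Fin.val_injective, Nat.card_Icc] at hle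
    omega
end
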